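/- Fix θ₁ ∈ (0,1), A > 0, δ > 0 and ε > 0. Set Y = X^{θ₁} and suppose Y^{ε} ≤ H ≤ Y^{1−ε}, with X sufficiently large. There exists B₀ = B₀(A) > 0 such that for every B ≥ B₀, with L = log X, P = L^B and z₀ = Y^{1/4}P^{−2}, the bound R₀(n) ≤ C r₂(n) 𝔖₂(n,P) L^{−1+δ} holds for all but O(H L^{−A}) integers n ∈ ℋ₂ ∩ (X, X+H], where R₀(n) is the number of triples of primes (p₁,p₂,p₃) with p₁ + (p₂p₃)² = n, p₁ ∈ I₁, z₀ < p₂ ≤ Y^{1/4}, p₂ ≤ p₃ and p₂p₃ ∈ I₂; the constant C and the implied constant depend at most on A, δ, ε and θ₁. -/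

import Mathlib

open scoped Classical
open MeasureTheory

noncomputable section

/-- `e x = exp(2 π i x)`. -/
def e (x : ℝ) : ℂ := Complex.exp (2 * Real.pi * Complex.I * x)

/-- `S(q,a) = ∑_{1 ≤ x ≤ q, (x,q)=1} e(a x² / q)`. -/
def Sqa (q : ℕ) (a : ℤ) : ℂ :=
  ∑ x ∈ (Finset.Icc 1 q).filter (fun x => Nat.gcd x q = 1),
    e ((a : ℝ) * (x : ℝ) ^ 2 / (q : ℝ))

/-- `A₂(n,q) = (μ(q)/φ(q)²) ∑_{1 ≤ a ≤ q, (a,q)=1} S(q,a) e(-a n / q)`. -/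
def A2 (n q : ℕ) : ℂ :=
  (((ArithmeticFunction.moebius q : ℤ) : ℝ) / ((Nat.totient q : ℝ)) ^ 2 : ℝ) *
    ∑ a ∈ (Finset.Icc 1 q).filter (fun a => Nat.gcd a q = 1),
      Sqa q a * e (-((a : ℝ) * (n : ℝ) / (q : ℝ)))

/-- `A₃(n,q) = φ(q)⁻³ ∑_{1 ≤ a ≤ q, (a,q)=1} S(q,a)³ e(-a n / q)`. -/
def A3 (n q : ℕ) : ℂ :=
  ((((Nat.totient q : ℝ)) ^ 3)⁻¹ : ℝ) *
    ∑ a ∈ (Finset.Icc 1 q).filter (fun a => Nat.gcd a q = 1),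
      (Sqa q a) ^ 3 * e (-((a : ℝ) * (n : ℝ) / (q : ℝ)))

/-- `𝔖₂(n,P) = ∑_{1 ≤ q ≤ P} A₂(n,q)`. -/
def SS2 (n : ℕ) (P : ℝ) : ℂ := ∑ q ∈ Finset.Icc 1 ⌊P⌋₊, A2 n q

/-- `𝔖₃(n,P) = ∑_{1 ≤ q ≤ P} A₃(n,q)`. -/
def SS3 (n : ℕ) (P : ℝ) : ℂ := ∑ q ∈ Finset.Icc 1 ⌊P⌋₊, A3 n q

/-- `𝔓₂(n,Q) = ∏_{p ≤ Q} (1 + A₂(n,p) + A₂(n,p²) + ⋯)`. -/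
def PP2 (n : ℕ) (Q : ℝ) : ℂ :=
  ∏ p ∈ (Finset.Icc 1 ⌊Q⌋₊).filter Nat.Prime, (1 + ∑' k : ℕ, A2 n (p ^ (k + 1)))

/-- `𝔓₃(n,Q) = ∏_{p ≤ Q} (1 + A₃(n,p) + A₃(n,p²) + ⋯)`. -/
def PP3 (n : ℕ) (Q : ℝ) : ℂ :=
  ∏ p ∈ (Finset.Icc 1 ⌊Q⌋₊).filter Nat.Prime, (1 + ∑' k : ℕ, A3 n (p ^ (k + 1)))

/-- `n ∈ ℋ₂`: `n` is a positive even integer with `n ≢ 1 (mod 3)`. -/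
def H2mem (n : ℕ) : Prop := 0 < n ∧ 2 ∣ n ∧ n % 3 ≠ 1

/-- `n ∈ ℋ₃`: `n ≡ 3 (mod 24)` and `5 ∤ n`. -/
def H3mem (n : ℕ) : Prop := n % 24 = 3 ∧ ¬ (5 ∣ n)

/-- `m ∈ I₁ = [X - Y, X)`. -/
def inI1 (X Y : ℝ) (m : ℕ) : Prop := X - Y ≤ (m : ℝ) ∧ (m : ℝ) < X

/-- `m ∈ I₂ = [Y^{1/2}/2, Y^{1/2})`. -/
def inI2 (Y : ℝ) (m : ℕ) : Prop := Real.sqrt Y / 2 ≤ (m : ℝ) ∧ (m : ℝ) < Real.sqrt Y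

/-- `R₂(n)`: the number of pairs of primes `(p₁, p₂)` with `p₁ + p₂² = n`,
`p₁ ∈ I₁`, `p₂ ∈ I₂`. -/
def R2cnt (X Y : ℝ) (n : ℕ) : ℕ :=
  Nat.card {p : ℕ × ℕ // p.1.Prime ∧ p.2.Prime ∧ p.1 + p.2 ^ 2 = n ∧
    inI1 X Y p.1 ∧ inI2 Y p.2}

/-- `r₂(n) = ∑_{m₁ + m₂² = n, m₁ ∈ I₁, m₂ ∈ I₂} 1 / (log m₁ · log m₂)`,
summed over pairs of positive integers. -/
def r2 (X Y : ℝ) (n : ℕ) : ℝ :=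
  ∑ m ∈ Finset.Ioc 0 n ×ˢ Finset.Ioc 0 n,
    if m.1 + m.2 ^ 2 = n ∧ inI1 X Y m.1 ∧ inI2 Y m.2
    then 1 / (Real.log m.1 * Real.log m.2) else 0

/-- The major arcs `𝔐 = ⋃_{q ≤ P} ⋃_{1 ≤ a ≤ q, (a,q)=1} [a/q - 1/(qQ), a/q + 1/(qQ)]`. -/
def majorArcs (P Q : ℝ) : Set ℝ :=
  ⋃ q ∈ Finset.Icc 1 ⌊P⌋₊, ⋃ a ∈ (Finset.Icc 1 q).filter (fun a => Nat.gcd a q = 1),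
    Set.Icc ((a : ℝ) / q - 1 / (q * Q)) ((a : ℝ) / q + 1 / (q * Q))

/-- The minor arcs `𝔪 = [1/Q, 1 + 1/Q] ∖ 𝔐`. -/
def minorArcs (P Q : ℝ) : Set ℝ := Set.Icc (1 / Q) (1 + 1 / Q) \ majorArcs P Q

/-- `D(χ) = 1` if `χ` is principal, `0` otherwise. -/
def Dind {q : ℕ} (χ : DirichletCharacter ℂ q) : ℂ := if χ = 1 then 1 else 0

/-- `R₀(n)` : the number of triples of primes `(p₁, p₂, p₃)` with `p₁ + (p₂p₃)² = n`,
`p₁ ∈ I₁`, `z₀ < p₂ ≤ Y^{1/4}`, `p₂ ≤ p₃` and `p₂p₃ ∈ I₂`. -/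
def R0cnt (X Y z₀ : ℝ) (n : ℕ) : ℕ :=
  Nat.card {p : ℕ × ℕ × ℕ // p.1.Prime ∧ p.2.1.Prime ∧ p.2.2.Prime ∧
    p.1 + (p.2.1 * p.2.2) ^ 2 = n ∧ inI1 X Y p.1 ∧
    z₀ < (p.2.1 : ℝ) ∧ (p.2.1 : ℝ) ≤ Y ^ (1/4 : ℝ) ∧ p.2.1 ≤ p.2.2 ∧
    inI2 Y (p.2.1 * p.2.2)}

theorem crt2 (D p : ℕ) (hD : 0 < D) (hp : 0 < p) (hc : Nat.Coprime p D) (u v : ℕ → ℝ)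
    (hu : ∀ x, u (x % p) = u x) (hv : ∀ x, v (x % D) = v x) :
    ∑ x ∈ Finset.range (p * D), u x * v x = (∑ x ∈ Finset.range p, u x) * ∑ x ∈ Finset.range D, v x := by
  rw [Finset.sum_mul_sum, ← Finset.sum_product']
  have hinj : Set.InjOn (fun x : ℕ => (x % p, x % D)) (Finset.range (p * D) : Set ℕ) := by
    intro x hx y hy h
    simp only [Prod.mk.injEq] at h
    have : x ≡ y [MOD p * D] := (Nat.modEq_and_modEq_iff_modEq_mul hc).1 ⟨h.1, h.2⟩
    simp only [Finset.coe_range, Set.mem_Iio] at hx hy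
    exact Nat.ModEq.eq_of_lt_of_lt this hx hy
  have himg : (Finset.range (p * D)).image (fun x : ℕ => (x % p, x % D)) = Finset.range p ×ˢ Finset.range D := by
    apply Finset.eq_of_subset_of_card_le
    · intro y hy
      simp only [Finset.mem_image, Finset.mem_range] at hy
      obtain ⟨x, hx, rfl⟩ := hy
      simp [Nat.mod_lt, hD, hp]
    · rw [Finset.card_image_of_injOn hinj]; simp
  rw [← himg, Finset.sum_image hinj]
  simp only [hu, hv]

theorem crtT (T : Finset ℕ) (hT : ∀ p ∈ T, p.Prime) (g : ℕ → ℕ → ℝ)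
    (hg : ∀ p ∈ T, ∀ x, g p (x % p) = g p x) :
    ∑ x ∈ Finset.range (∏ p ∈ T, p), ∏ p ∈ T, g p x = ∏ p ∈ T, ∑ x ∈ Finset.range p, g p x := by
  induction T using Finset.induction_on with
  | empty => simp
  | insert q T hq ih =>
    rw [Finset.prod_insert hq, Finset.prod_insert hq, ← ih (fun p hp => hT p (by simp [hp])) (fun p hp => hg p (by simp [hp]))]
    simp only [Finset.prod_insert hq]
    apply crt2
    · exact Finset.prod_pos (fun p hp => (hT p (by simp [hp])).pos)
    · exact (hT q (by simp)).pos
    · apply Nat.Coprime.prod_right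
      intro p hp
      exact (Nat.coprime_primes (hT q (by simp)) (hT p (by simp [hp]))).2 (by rintro rfl; exact hq hp)
    · exact hg q (by simp)
    · intro x
      apply Finset.prod_congr rfl
      intro p hp
      rw [← hg p (by simp [hp]), Nat.mod_mod_of_dvd _ (Finset.dvd_prod_of_mem _ hp), hg p (by simp [hp])]

theorem period_sum (D : ℕ) (hD : 0 < D) (G : ℕ → ℝ) (hG : ∀ x, G (x % D) = G x) (a : ℕ) :
    ∑ x ∈ Finset.Ico a (a + D), G x = ∑ x ∈ Finset.range D, G x := by
  induction a with
  | zero => simp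
  | succ a ih =>
    rw [← ih]
    have h1 : ∑ x ∈ Finset.Ico a (a + D), G x + G (a + D) = ∑ x ∈ Finset.Ico a (a + D + 1), G x :=
      (Finset.sum_Ico_succ_top (by omega) _).symm
    have h2 : ∑ x ∈ Finset.Ico a (a + D + 1), G x = G a + ∑ x ∈ Finset.Ico (a+1) (a + D + 1), G x :=
      Finset.sum_eq_sum_Ico_succ_bot (by omega) _
    have h3 : G (a + D) = G a := by rw [← hG, Nat.add_mod_right, hG]
    rw [show a + 1 + D = a + D + 1 by ring]
    linarith

theorem interval_sum (D : ℕ) (hD : 0 < D) (G : ℕ → ℝ) (hG : ∀ x, G (x % D) = G x)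
    (hb : ∀ x, |G x| ≤ 1) (a h : ℕ) :
    |∑ x ∈ Finset.Ico a (a + h), G x - h / D * ∑ x ∈ Finset.range D, G x| ≤ 2 * D := by
  have hS : |∑ x ∈ Finset.range D, G x| ≤ D := by
    refine (Finset.abs_sum_le_sum_abs _ _).trans ?_
    refine (Finset.sum_le_sum (fun x _ => hb x)).trans ?_
    simp
  induction h using Nat.strong_induction_on generalizing a with
  | _ h ih =>
    by_cases hh : h < D
    · have h1 : |∑ x ∈ Finset.Ico a (a + h), G x| ≤ h := by
        refine (Finset.abs_sum_le_sum_abs _ _).trans ?_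
        refine (Finset.sum_le_sum (fun x _ => hb x)).trans ?_
        simp
      have hD' : (0:ℝ) < D := by exact_mod_cast hD
      have h2 : |(h:ℝ) / D * ∑ x ∈ Finset.range D, G x| ≤ h := by
        rw [abs_mul, abs_of_nonneg (by positivity)]
        calc (h:ℝ) / D * |∑ x ∈ Finset.range D, G x| ≤ h / D * D := by gcongr
          _ = h := by field_simp
      have h3 : (h:ℝ) ≤ D := by exact_mod_cast hh.le
      have := abs_sub (∑ x ∈ Finset.Ico a (a + h), G x) ((h:ℝ) / D * ∑ x ∈ Finset.range D, G x)
      linarith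
    · push Not at hh
      obtain ⟨k, rfl⟩ := Nat.exists_eq_add_of_le hh
      have := ih k (by omega) (a + D)
      rw [← Finset.sum_Ico_consecutive _ (show a ≤ a + D by omega) (show a + D ≤ a + (D + k) by omega),
        period_sum D hD G hG, ← add_assoc]
      have hD' : (0:ℝ) < D := by exact_mod_cast hD
      convert this using 2
      push_cast
      field_simp
      ring

theorem bonf (S : Finset ℕ) (b : ℕ) :
    (if S = ∅ then (1:ℝ) else 0) ≤ ∑ T ∈ S.powerset with T.card ≤ 2 * b, (-1:ℝ) ^ T.card := by
  have key : ∑ T ∈ S.powerset with T.card ≤ 2 * b, (-1:ℤ) ^ T.card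
      = ∑ k ∈ Finset.range (2 * b + 1), (-1:ℤ) ^ k * (S.card.choose k) := by
    rw [← Finset.sum_fiberwise_of_maps_to (g := Finset.card) (t := Finset.range (2*b+1))]
    · apply Finset.sum_congr rfl
      intro k hk
      rw [Finset.sum_congr rfl (g := fun _ => (-1:ℤ)^k)]
      · rw [Finset.sum_const, ← Finset.card_powersetCard, nsmul_eq_mul, mul_comm]
        congr 3
        ext T
        simp only [Finset.mem_filter, Finset.mem_powerset, Finset.mem_powersetCard, Finset.mem_range] at *
        constructor
        · tauto
        · rintro ⟨h1, h2⟩; exact ⟨⟨h1, by omega⟩, h2⟩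
      · intro T hT
        simp only [Finset.mem_filter] at hT
        rw [hT.2]
    · intro T hT
      simp only [Finset.mem_filter, Finset.mem_range] at *
      omega
  have : (if S = ∅ then (1:ℤ) else 0) ≤ ∑ T ∈ S.powerset with T.card ≤ 2 * b, (-1:ℤ) ^ T.card := by
    rw [key]
    split_ifs with h
    · subst h
      rw [Finset.sum_range_succ']
      simp
    · obtain ⟨m, hm⟩ : ∃ m, S.card = m + 1 := ⟨S.card - 1, by have := Finset.card_pos.2 (Finset.nonempty_iff_ne_empty.2 h); omega⟩
      rw [hm, Int.alternating_sum_range_choose_eq_choose]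
      simp
  exact_mod_cast this

theorem tail_bd (S : Finset ℕ) (b : ℕ) (g : ℕ → ℝ) (hg : ∀ p ∈ S, 0 ≤ g p) :
    ∑ T ∈ S.powerset with b < T.card, ∏ p ∈ T, g p ≤ (1/2)^b * ∏ p ∈ S, (1 + 2 * g p) := by
  rw [Finset.prod_one_add, Finset.mul_sum]
  refine le_trans ?_ (Finset.sum_le_sum_of_subset_of_nonneg (Finset.filter_subset (fun T => b < T.card) _) ?_)
  · apply Finset.sum_le_sum
    intro T hT
    simp only [Finset.mem_filter, Finset.mem_powerset] at hT
    rw [Finset.prod_mul_distrib, Finset.prod_const, ← mul_assoc]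
    have h1 : (1:ℝ) ≤ (1/2)^b * 2^T.card := by
      rw [one_div, inv_pow]
      have : (2:ℝ)^b ≤ 2^T.card := pow_le_pow_right₀ (by norm_num) hT.2.le
      rw [inv_mul_eq_div, le_div_iff₀ (by positivity)]; linarith
    exact le_mul_of_one_le_left (Finset.prod_nonneg (fun p hp => hg p (hT.1 hp))) h1
  · intro T hT _
    have : ∀ p ∈ T, 0 ≤ 2 * g p := fun p hp => by have := hg p (Finset.mem_powerset.1 hT hp); linarith
    have := Finset.prod_nonneg this
    positivity

theorem card_small (S : Finset ℕ) (hS : ∀ p ∈ S, p.Prime) (𝒯 : Finset (Finset ℕ)) (h𝒯 : 𝒯 ⊆ S.powerset) (Q : ℕ)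
    (hQ : ∀ T ∈ 𝒯, ∏ p ∈ T, p ≤ Q) : 𝒯.card ≤ Q := by
  have hinj : Set.InjOn (fun T : Finset ℕ => ∏ p ∈ T, p) (𝒯 : Set (Finset ℕ)) := by
    intro T hT T' hT' h
    have h1 : ∀ p ∈ T, p.Prime := fun p hp => hS p (Finset.mem_powerset.1 (h𝒯 hT) hp)
    have h2 : ∀ p ∈ T', p.Prime := fun p hp => hS p (Finset.mem_powerset.1 (h𝒯 hT') hp)
    rw [← Nat.primeFactors_prod h1, ← Nat.primeFactors_prod h2]
    simp only at h
    rw [h]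
  rw [← Finset.card_image_of_injOn hinj]
  have : 𝒯.image (fun T : Finset ℕ => ∏ p ∈ T, p) ⊆ Finset.Icc 1 Q := by
    intro y hy
    simp only [Finset.mem_image] at hy
    obtain ⟨T, hT, rfl⟩ := hy
    rw [Finset.mem_Icc]
    exact ⟨Finset.prod_pos (fun p hp => (hS p (Finset.mem_powerset.1 (h𝒯 hT) hp)).pos), hQ T hT⟩
  simpa using Finset.card_le_card this

theorem sieve_bd (S : Finset ℕ) (hS : ∀ p ∈ S, p.Prime) (ρ : ℕ → ℕ → Prop)
    (hρ : ∀ p ∈ S, ∀ x, ρ p (x % p) ↔ ρ p x) (w : ℕ → ℝ)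
    (hw : ∀ p ∈ S, w p = ((Finset.range p).filter (fun x => ρ p x)).card)
    (b Q : ℕ) (hQ : ∀ T ⊆ S, T.card ≤ 2 * b → ∏ p ∈ T, p ≤ Q) (a h : ℕ) :
    (((Finset.Ico a (a + h)).filter (fun x => ∀ p ∈ S, ¬ ρ p x)).card : ℝ)
      ≤ h * (∏ p ∈ S, (1 - w p / p) + (1/2)^(2*b) * ∏ p ∈ S, (1 + 2 * (w p / p))) + 2 * Q^2 := by
  set 𝒯 := S.powerset.filter (fun T => T.card ≤ 2 * b) with h𝒯
  have hmem : ∀ T ∈ 𝒯, T ⊆ S ∧ T.card ≤ 2 * b := by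
    intro T hT; simpa [h𝒯] using hT
  have hwn : ∀ p ∈ S, 0 ≤ w p / p := fun p hp => by rw [hw p hp]; positivity
  -- step 1
  have h1 : (((Finset.Ico a (a + h)).filter (fun x => ∀ p ∈ S, ¬ ρ p x)).card : ℝ)
      ≤ ∑ x ∈ Finset.Ico a (a + h), ∑ T ∈ 𝒯, (-1:ℝ)^T.card * ∏ p ∈ T, (if ρ p x then (1:ℝ) else 0) := by
    rw [Finset.card_filter]
    push_cast
    apply Finset.sum_le_sum
    intro x hx
    have hb := bonf (S.filter (fun p => ρ p x)) b
    have e1 : (if ∀ p ∈ S, ¬ ρ p x then (1:ℝ) else 0) = if S.filter (fun p => ρ p x) = ∅ then (1:ℝ) else 0 := by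
      simp only [Finset.filter_eq_empty_iff]
    rw [e1]
    refine hb.trans (le_of_eq ?_)
    have e2 : ∀ T ∈ 𝒯, (-1:ℝ)^T.card * ∏ p ∈ T, (if ρ p x then (1:ℝ) else 0)
        = if T ⊆ S.filter (fun p => ρ p x) then (-1:ℝ)^T.card else 0 := by
      intro T hT
      split_ifs with hc
      · rw [Finset.prod_eq_one, mul_one]
        intro p hp
        rw [if_pos (Finset.mem_filter.1 (hc hp)).2]
      · obtain ⟨p, hp, hp'⟩ := Finset.not_subset.1 hc
        have : ¬ ρ p x := fun hh => hp' (Finset.mem_filter.2 ⟨(hmem T hT).1 hp, hh⟩)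
        rw [Finset.prod_eq_zero hp (if_neg this), mul_zero]
    rw [Finset.sum_congr rfl e2, ← Finset.sum_filter]
    apply Finset.sum_congr _ (fun _ _ => rfl)
    ext T
    simp only [h𝒯, Finset.mem_filter, Finset.mem_powerset]
    constructor
    · rintro ⟨hh, h2⟩; exact ⟨⟨hh.trans (Finset.filter_subset _ _), h2⟩, hh⟩
    · rintro ⟨⟨_, h2⟩, hh⟩; exact ⟨hh, h2⟩
  have h2 : ∀ T ∈ 𝒯, (-1:ℝ)^T.card * ∑ x ∈ Finset.Ico a (a + h), ∏ p ∈ T, (if ρ p x then (1:ℝ) else 0)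
      ≤ h * ∏ p ∈ T, (- (w p / p)) + 2 * Q := by
    intro T hT
    obtain ⟨hTS, hTc⟩ := hmem T hT
    have hpr : ∀ p ∈ T, p.Prime := fun p hp => hS p (hTS hp)
    have hD : 0 < ∏ p ∈ T, p := Finset.prod_pos (fun p hp => (hpr p hp).pos)
    have hper : ∀ p ∈ T, ∀ x, (if ρ p (x % p) then (1:ℝ) else 0) = if ρ p x then (1:ℝ) else 0 := by
      intro p hp x; simp only [hρ p (hTS hp)]
    have := interval_sum (∏ p ∈ T, p) hD (fun x => ∏ p ∈ T, (if ρ p x then (1:ℝ) else 0)) ?_ ?_ a h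
    · rw [crtT T hpr (fun p x => if ρ p x then (1:ℝ) else 0) hper] at this
      have e3 : (h:ℝ) / (∏ p ∈ T, p : ℕ) * ∏ p ∈ T, ∑ x ∈ Finset.range p, (if ρ p x then (1:ℝ) else 0)
          = h * ∏ p ∈ T, (w p / p) := by
        rw [Finset.prod_div_distrib]
        push_cast
        rw [div_mul_eq_mul_div, mul_div_assoc]
        congr 2
        apply Finset.prod_congr rfl
        intro p hp
        rw [hw p (hTS hp), Finset.card_filter]
        push_cast; rfl
      rw [e3] at this
      have hq : ((∏ p ∈ T, p : ℕ) : ℝ) ≤ Q := by exact_mod_cast hQ T hTS hTc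
      rw [Finset.prod_neg]
      rcases neg_one_pow_eq_or ℝ T.card with hs | hs
      · rw [hs]
        have := (abs_le.1 this).2
        linarith
      · rw [hs]
        have := (abs_le.1 this).1
        linarith
    · intro x
      apply Finset.prod_congr rfl
      intro p hp
      rw [← hper p hp, Nat.mod_mod_of_dvd _ (Finset.dvd_prod_of_mem _ hp), hper p hp]
    · intro x
      rw [Finset.abs_prod]
      apply Finset.prod_le_one
      · intros; positivity
      · intros; split_ifs <;> simp
  have hcard : (𝒯.card : ℝ) ≤ Q := by
    exact_mod_cast card_small S hS 𝒯 (Finset.filter_subset _ _) Q (fun T hT => hQ T (hmem T hT).1 (hmem T hT).2)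
  have h3 : ∑ T ∈ 𝒯, ∏ p ∈ T, (- (w p / p)) ≤ ∏ p ∈ S, (1 - w p / p) + (1/2)^(2*b) * ∏ p ∈ S, (1 + 2 * (w p / p)) := by
    have ht := tail_bd S (2*b) (fun p => w p / p) hwn
    have hf : ∏ p ∈ S, (1 - w p / p) = ∑ T ∈ S.powerset, ∏ p ∈ T, (-(w p/p)) := by
      rw [← Finset.prod_one_add]; simp [sub_eq_add_neg]
    rw [← Finset.sum_filter_add_sum_filter_not S.powerset (fun T => T.card ≤ 2 * b)] at hf
    have hl : -∑ T ∈ S.powerset with 2 * b < T.card, ∏ p ∈ T, w p / p ≤ ∑ T ∈ S.powerset with ¬ T.card ≤ 2 * b, ∏ p ∈ T, (-(w p/p)) := by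
      rw [← Finset.sum_neg_distrib]
      simp only [not_le]
      apply Finset.sum_le_sum
      intro T hT
      have hTS := Finset.mem_powerset.1 (Finset.mem_filter.1 hT).1
      rw [Finset.prod_neg]
      have := Finset.prod_nonneg (fun p hp => hwn p (hTS hp))
      rcases neg_one_pow_eq_or ℝ T.card with hs | hs <;> rw [hs] <;> linarith
    linarith
  calc _ ≤ _ := h1
    _ = ∑ T ∈ 𝒯, (-1:ℝ)^T.card * ∑ x ∈ Finset.Ico a (a + h), ∏ p ∈ T, (if ρ p x then (1:ℝ) else 0) := by
      rw [Finset.sum_comm]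
      simp only [Finset.mul_sum]
    _ ≤ ∑ T ∈ 𝒯, (h * ∏ p ∈ T, (- (w p / p)) + 2 * Q) := Finset.sum_le_sum h2
    _ = h * ∑ T ∈ 𝒯, ∏ p ∈ T, (- (w p / p)) + 𝒯.card * (2 * Q) := by
      rw [Finset.sum_add_distrib, ← Finset.mul_sum]; simp
    _ ≤ h * (∏ p ∈ S, (1 - w p / p) + (1/2)^(2*b) * ∏ p ∈ S, (1 + 2 * (w p / p))) + Q * (2 * Q) := by
      gcongr
    _ = _ := by ring

theorem variance_bd (S : Finset ℕ) (hS : ∀ p ∈ S, p.Prime) (f : ℕ → ℕ → ℝ)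
    (hf : ∀ p ∈ S, ∀ x, f p (x % p) = f p x) (hf1 : ∀ p ∈ S, ∀ x, |f p x| ≤ 1)
    (hf3 : ∀ p ∈ S, ∀ x, |f p x| ≤ 3 / p) (hf0 : ∀ p ∈ S, ∑ x ∈ Finset.range p, f p x = 0)
    (𝒯 : Finset (Finset ℕ)) (h𝒯 : 𝒯 ⊆ S.powerset) (Q : ℕ)
    (hQ : ∀ T ∈ 𝒯, ∏ p ∈ T, p ≤ Q) (a h : ℕ) :
    ∑ n ∈ Finset.Ico a (a + h), (∑ T ∈ 𝒯, ∏ p ∈ T, f p n)^2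
      ≤ h * ∑ T ∈ 𝒯, ∏ p ∈ T, (9 / (p:ℝ)^2) + 2 * Q^4 := by
  have hmem : ∀ T ∈ 𝒯, T ⊆ S := fun T hT => Finset.mem_powerset.1 (h𝒯 hT)
  have hcard : (𝒯.card : ℝ) ≤ Q := by
    exact_mod_cast card_small S hS 𝒯 h𝒯 Q hQ
  have main : ∀ T ∈ 𝒯, ∀ T' ∈ 𝒯, ∑ n ∈ Finset.Ico a (a + h), (∏ p ∈ T, f p n) * (∏ p ∈ T', f p n)
      ≤ h * (if T = T' then ∏ p ∈ T, (9 / (p:ℝ)^2) else 0) + 2 * Q^2 := by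
    intro T hT T' hT'
    set U := T ∪ T' with hU
    have hUS : U ⊆ S := Finset.union_subset (hmem T hT) (hmem T' hT')
    have hpr : ∀ p ∈ U, p.Prime := fun p hp => hS p (hUS hp)
    have hD : 0 < ∏ p ∈ U, p := Finset.prod_pos (fun p hp => (hpr p hp).pos)
    set k : ℕ → ℕ → ℝ := fun p n => (if p ∈ T then f p n else 1) * (if p ∈ T' then f p n else 1) with hk
    have hprod : ∀ n, (∏ p ∈ T, f p n) * (∏ p ∈ T', f p n) = ∏ p ∈ U, k p n := by
      intro n
      rw [hk, Finset.prod_mul_distrib, Finset.prod_ite_mem, Finset.prod_ite_mem]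
      congr 2
      · rw [hU]; ext; simp
      · rw [hU]; ext; simp
    have hper : ∀ p ∈ U, ∀ x, k p (x % p) = k p x := by
      intro p hp x; simp only [hk, hf p (hUS hp)]
    have := interval_sum (∏ p ∈ U, p) hD (fun x => ∏ p ∈ U, k p x) ?_ ?_ a h
    · rw [crtT U hpr k hper] at this
      simp only [hprod]
      have hq : ((∏ p ∈ U, p : ℕ) : ℝ) ≤ Q^2 := by
        have h1 : ∏ p ∈ U, p ≤ (∏ p ∈ T, p) * ∏ p ∈ T', p := by
          rw [← Finset.prod_union_inter]
          apply Nat.le_mul_of_pos_right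
          exact Finset.prod_pos (fun p hp => (hpr p (Finset.mem_union_left _ (Finset.mem_inter.1 hp).1)).pos)
        have h2 : ∏ p ∈ U, p ≤ Q ^ 2 := by
          rw [sq]
          exact h1.trans (Nat.mul_le_mul (hQ T hT) (hQ T' hT'))
        exact_mod_cast h2
      have hle : (h:ℝ) / (∏ p ∈ U, p : ℕ) * ∏ p ∈ U, ∑ x ∈ Finset.range p, k p x ≤ h * (if T = T' then ∏ p ∈ T, (9 / (p:ℝ)^2) else 0) := by
        split_ifs with hTT
        · subst hTT
          have hUT : U = T := by simp [hU]
          rw [hUT, div_mul_eq_mul_div, mul_div_assoc]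
          gcongr
          push_cast
          rw [← Finset.prod_div_distrib]
          apply Finset.prod_le_prod
          · intro p hp
            apply div_nonneg _ (by positivity)
            apply Finset.sum_nonneg
            intro x hx
            simp only [hk, if_pos hp]
            exact mul_self_nonneg _
          · intro p hp
            have hp0 : (0:ℝ) < p := by exact_mod_cast (hpr p (hUT ▸ hp)).pos
            rw [div_le_iff₀ hp0]
            have : ∀ x ∈ Finset.range p, k p x ≤ 9 / (p:ℝ)^2 := by
              intro x hx
              simp only [hk, if_pos hp]
              have h3 := hf3 p (hmem T hT hp) x
              rw [← abs_mul_abs_self]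
              calc |f p x| * |f p x| ≤ (3 / p) * (3 / p) := by gcongr
                _ = _ := by ring
            refine (Finset.sum_le_sum this).trans ?_
            simp; rw [mul_comm]
        · have : ∃ p ∈ U, ∑ x ∈ Finset.range p, k p x = 0 := by
            have : ∃ p, ¬ (p ∈ T ↔ p ∈ T') := by
              by_contra hcon
              push Not at hcon
              exact hTT (Finset.ext (fun p => hcon p))
            obtain ⟨p, hp⟩ := this
            by_cases hpT : p ∈ T
            · have hpT' : p ∉ T' := by tauto
              have hpU : p ∈ U := Finset.mem_union_left _ hpT
              refine ⟨p, hpU, ?_⟩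
              simp only [hk, if_pos hpT, if_neg hpT', mul_one]
              exact hf0 p (hUS hpU)
            · have hpT' : p ∈ T' := by tauto
              have hpU : p ∈ U := Finset.mem_union_right _ hpT'
              refine ⟨p, hpU, ?_⟩
              simp only [hk, if_pos hpT', if_neg hpT, one_mul]
              exact hf0 p (hUS hpU)
          obtain ⟨p, hp, hp0⟩ := this
          rw [Finset.prod_eq_zero (f := fun p => ∑ x ∈ Finset.range p, k p x) hp hp0, mul_zero, mul_zero]
      have := (abs_le.1 this).2
      linarith
    · intro x
      apply Finset.prod_congr rfl
      intro p hp
      rw [← hper p hp, Nat.mod_mod_of_dvd _ (Finset.dvd_prod_of_mem _ hp), hper p hp]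
    · intro x
      rw [Finset.abs_prod]
      apply Finset.prod_le_one
      · intros; positivity
      · intro p hp
        have := hf1 p (hUS hp) x
        simp only [hk]
        rw [abs_mul]
        apply mul_le_one₀ _ (abs_nonneg _)
        · split_ifs <;> simp [this]
        · split_ifs <;> simp [this]
  calc _ = ∑ T ∈ 𝒯, ∑ T' ∈ 𝒯, ∑ n ∈ Finset.Ico a (a + h), (∏ p ∈ T, f p n) * (∏ p ∈ T', f p n) := by
        simp only [sq, Finset.sum_mul_sum]
        rw [Finset.sum_comm]
        apply Finset.sum_congr rfl
        intro T _
        rw [Finset.sum_comm]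
    _ ≤ ∑ T ∈ 𝒯, ∑ T' ∈ 𝒯, ((h:ℝ) * (if T = T' then ∏ p ∈ T, (9 / (p:ℝ)^2) else 0) + 2 * (Q:ℝ)^2) :=
        Finset.sum_le_sum (fun T hT => Finset.sum_le_sum (fun T' hT' => main T hT T' hT'))
    _ = h * ∑ T ∈ 𝒯, ∏ p ∈ T, (9 / (p:ℝ)^2) + 𝒯.card * (𝒯.card * (2 * Q^2)) := by
        have e : ∀ T ∈ 𝒯, ∑ T' ∈ 𝒯, ((h:ℝ) * (if T = T' then ∏ p ∈ T, (9 / (p:ℝ)^2) else 0) + 2 * (Q:ℝ)^2)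
            = h * ∏ p ∈ T, (9 / (p:ℝ)^2) + 𝒯.card * (2 * (Q:ℝ)^2) := by
          intro T hT
          rw [Finset.sum_add_distrib, ← Finset.mul_sum, Finset.sum_const, nsmul_eq_mul]
          simp [hT]
        rw [Finset.sum_congr rfl e, Finset.sum_add_distrib, ← Finset.mul_sum, Finset.sum_const, nsmul_eq_mul]
    _ ≤ h * ∑ T ∈ 𝒯, ∏ p ∈ T, (9 / (p:ℝ)^2) + Q * (Q * (2 * Q^2)) := by gcongr
    _ = _ := by ring

theorem variance_bd2 (S : Finset ℕ) (𝒯 : Finset (Finset ℕ)) (h𝒯 : 𝒯 ⊆ S.powerset)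
    (P : ℝ) (hP : 0 < P) (hT : ∀ T ∈ 𝒯, P < ((∏ p ∈ T, p : ℕ) : ℝ)) :
    ∑ T ∈ 𝒯, ∏ p ∈ T, (9 / (p:ℝ)^2) ≤ P⁻¹ * ∏ p ∈ S, (1 + 9 / (p:ℝ)) := by
  rw [Finset.prod_one_add, Finset.mul_sum]
  refine le_trans ?_ (Finset.sum_le_sum_of_subset_of_nonneg h𝒯 ?_)
  · apply Finset.sum_le_sum
    intro T hTT
    have hpos : 0 < ((∏ p ∈ T, p : ℕ) : ℝ) := hP.trans (hT T hTT)
    have e1 : ∏ p ∈ T, (9 / (p:ℝ)^2) = ((∏ p ∈ T, p : ℕ) : ℝ)⁻¹ * ∏ p ∈ T, (9 / (p:ℝ)) := by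
      push_cast
      rw [← Finset.prod_inv_distrib, ← Finset.prod_mul_distrib]
      apply Finset.prod_congr rfl
      intro p _
      rw [sq, ← div_div, inv_mul_eq_div]
    rw [e1]
    have := hT T hTT
    gcongr
  · intro T _ _
    positivity

theorem e_add (x y : ℝ) : e (x + y) = e x * e y := by
  unfold e; rw [← Complex.exp_add]; push_cast; ring_nf

theorem e_nat_mul (a : ℕ) (x : ℝ) : e (a * x) = e x ^ a := by
  unfold e; rw [← Complex.exp_nat_mul]; push_cast; ring_nf

theorem e_eq_one_iff (x : ℝ) : e x = 1 ↔ ∃ k : ℤ, x = k := by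
  unfold e
  rw [Complex.exp_eq_one_iff]
  constructor
  · rintro ⟨k, hk⟩
    refine ⟨k, ?_⟩
    have h2 : (2 * Real.pi * Complex.I : ℂ) ≠ 0 := Complex.two_pi_I_ne_zero
    have : (2 * Real.pi * Complex.I : ℂ) * x = (2 * Real.pi * Complex.I : ℂ) * k := by rw [hk]; ring
    have := mul_left_cancel₀ h2 this
    exact_mod_cast this
  · rintro ⟨k, rfl⟩
    exact ⟨k, by push_cast; ring⟩

theorem complete_sum (q : ℕ) (hq : 0 < q) (m : ℤ) :
    ∑ a ∈ Finset.Icc 1 q, e ((a:ℝ) * m / q) = if (q:ℤ) ∣ m then (q:ℂ) else 0 := by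
  have hq' : (q:ℝ) ≠ 0 := by positivity
  have h1 : ∀ a : ℕ, e ((a:ℝ) * m / q) = e (m / q) ^ a := by
    intro a; rw [← e_nat_mul, mul_div_assoc]
  simp only [h1]
  have hone : e (m / q) = 1 ↔ (q:ℤ) ∣ m := by
    rw [e_eq_one_iff]
    constructor
    · rintro ⟨k, hk⟩
      refine ⟨k, ?_⟩
      rw [div_eq_iff hq'] at hk
      have : m = k * q := by exact_mod_cast hk
      rw [this]; ring
    · rintro ⟨k, rfl⟩
      exact ⟨k, by push_cast; field_simp⟩
  split_ifs with h
  · rw [hone.2 h]; simp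
  · have hne : e (m / q) ≠ 1 := fun hh => h (hone.1 hh)
    have hp : e (m / q) ^ q = 1 := by
      rw [← e_nat_mul, e_eq_one_iff]
      exact ⟨m, by field_simp⟩
    have : ∑ a ∈ Finset.Icc 1 q, e (m / q) ^ a = e (m/q) * ∑ a ∈ Finset.range q, e (m/q) ^ a := by
      rw [Finset.mul_sum, Finset.range_eq_Ico, Finset.sum_Ico_eq_sum_range]
      have : Finset.Icc 1 q = Finset.Ico 1 (q+1) := by ext; simp
      rw [this, Finset.sum_Ico_eq_sum_range]
      simp only [Nat.add_sub_cancel, Nat.sub_zero]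
      apply Finset.sum_congr rfl
      intro a _
      rw [pow_add, pow_one, zero_add]
    rw [this, geom_sum_eq hne, hp]; simp

def ram (m : ℤ) (q : ℕ) : ℂ :=
  ∑ a ∈ (Finset.Icc 1 q).filter (fun a => Nat.gcd a q = 1), e ((a:ℝ) * m / q)

theorem ram_sum (m : ℤ) (q : ℕ) (hq : 0 < q) :
    ∑ d ∈ q.divisors, ram m d = if (q:ℤ) ∣ m then (q:ℂ) else 0 := by
  rw [← complete_sum q hq m]
  rw [← Finset.sum_fiberwise_of_maps_to (s := Finset.Icc 1 q) (g := fun a => q / Nat.gcd a q) (t := q.divisors)]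
  · apply Finset.sum_congr rfl
    intro d hd
    obtain ⟨k, rfl⟩ := (Nat.mem_divisors.1 hd).1
    have hd0 : 0 < d := Nat.pos_of_mul_pos_right hq
    have hk0 : 0 < k := Nat.pos_of_mul_pos_left hq
    unfold ram
    apply Finset.sum_nbij' (fun a => a * k) (fun a => a / k)
    · intro a ha
      simp only [Finset.mem_filter, Finset.mem_Icc] at ha ⊢
      refine ⟨⟨Nat.mul_pos ha.1.1 hk0, Nat.mul_le_mul_right _ ha.1.2⟩, ?_⟩
      rw [Nat.gcd_mul_right, ha.2, one_mul, Nat.mul_div_cancel _ hk0]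
    · intro a ha
      simp only [Finset.mem_filter, Finset.mem_Icc] at ha ⊢
      obtain ⟨⟨h1, h2⟩, h3⟩ := ha
      have hg : Nat.gcd a (d * k) = k := by
        have hdv : Nat.gcd a (d*k) ∣ d * k := Nat.gcd_dvd_right _ _
        have := Nat.div_mul_cancel hdv
        rw [h3] at this
        exact Nat.eq_of_mul_eq_mul_left hd0 this
      have hka : k ∣ a := hg ▸ Nat.gcd_dvd_left a (d*k)
      obtain ⟨c, rfl⟩ := hka
      rw [Nat.mul_div_cancel_left _ hk0]
      rw [mul_comm k c, Nat.gcd_mul_right] at hg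
      refine ⟨⟨Nat.pos_of_mul_pos_left h1, ?_⟩, ?_⟩
      · rw [mul_comm] at h2; exact Nat.le_of_mul_le_mul_right h2 hk0
      · exact Nat.eq_of_mul_eq_mul_right hk0 (by rw [hg, one_mul])
    · intro a ha; exact Nat.mul_div_cancel _ hk0
    · intro a ha
      simp only [Finset.mem_filter, Finset.mem_Icc] at ha
      obtain ⟨⟨h1, h2⟩, h3⟩ := ha
      have hg : Nat.gcd a (d * k) = k := by
        have hdv : Nat.gcd a (d*k) ∣ d * k := Nat.gcd_dvd_right _ _
        have := Nat.div_mul_cancel hdv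
        rw [h3] at this
        exact Nat.eq_of_mul_eq_mul_left hd0 this
      exact Nat.div_mul_cancel (hg ▸ Nat.gcd_dvd_left a (d*k))
    · intro a ha
      congr 1
      push_cast
      have : (k:ℝ) ≠ 0 := by positivity
      have : (d:ℝ) ≠ 0 := by positivity
      field_simp
  · intro a ha
    simp only [Nat.mem_divisors]
    exact ⟨Nat.div_dvd_of_dvd (Nat.gcd_dvd_right _ _), hq.ne'⟩

def Jf (m : ℤ) : ArithmeticFunction ℂ :=
  ⟨fun q => if (q:ℤ) ∣ m then (q:ℂ) else 0, by simp⟩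

theorem Jf_mult (m : ℤ) : (Jf m).IsMultiplicative := by
  constructor
  · simp [Jf]
  · intro a b hab
    simp only [Jf, ArithmeticFunction.coe_mk]
    have : ((a * b : ℕ) : ℤ) ∣ m ↔ (a:ℤ) ∣ m ∧ (b:ℤ) ∣ m := by
      push_cast
      constructor
      · intro h; exact ⟨(dvd_mul_right _ _).trans h, (dvd_mul_left _ _).trans h⟩
      · rintro ⟨h1, h2⟩; exact IsCoprime.mul_dvd (Nat.isCoprime_iff_coprime.2 hab) h1 h2
    by_cases h1 : (a:ℤ) ∣ m <;> by_cases h2 : (b:ℤ) ∣ m <;> simp only [this, h1, h2] <;> simp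

def cp (p : ℕ) (m : ℤ) : ℝ := (if (p:ℤ) ∣ m then (p:ℝ) else 0) - 1

theorem ram_prod (m : ℤ) (T : Finset ℕ) (hT : ∀ p ∈ T, p.Prime) :
    ram m (∏ p ∈ T, p) = ((∏ p ∈ T, cp p m : ℝ) : ℂ) := by
  have h := (ArithmeticFunction.sum_eq_iff_sum_mul_moebius_eq (f := ram m)
    (g := fun q => if (q:ℤ) ∣ m then (q:ℂ) else 0)).1 (fun q hq => ram_sum m q hq)
  have h' : ∀ q > 0, ((ArithmeticFunction.moebius : ArithmeticFunction ℂ) * Jf m) q = ram m q := by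
    intro q hq
    rw [← h q hq, ArithmeticFunction.mul_apply]
    rfl
  have hm : ((ArithmeticFunction.moebius : ArithmeticFunction ℂ) * Jf m).IsMultiplicative :=
    (ArithmeticFunction.isMultiplicative_moebius.intCast).mul (Jf_mult m)
  rw [← h' _ (Finset.prod_pos (fun p hp => (hT p hp).pos))]
  have := ArithmeticFunction.IsMultiplicative.map_prod (fun p : ℕ => p) hm T (by
    intro p hp q hq hpq
    exact (Nat.coprime_primes (hT p hp) (hT q hq)).2 hpq)
  rw [this]
  push_cast
  apply Finset.prod_congr rfl
  intro p hp
  rw [ArithmeticFunction.mul_apply, Nat.sum_divisorsAntidiagonal (f := fun a b => (ArithmeticFunction.moebius : ArithmeticFunction ℂ) a * (Jf m) b),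
    Nat.Prime.sum_divisors (hT p hp)]
  simp [Jf, Nat.div_self (hT p hp).pos, cp, ArithmeticFunction.moebius_apply_prime (hT p hp)]
  split_ifs <;> push_cast <;> ring

def nu (p n : ℕ) : ℕ := ((Finset.range p).filter (fun x => ¬ p ∣ x ∧ (p:ℤ) ∣ (x:ℤ)^2 - n)).card

def fp (p n : ℕ) : ℝ := (((p:ℝ) - 1) - p * nu p n) / ((p:ℝ) - 1)^2

theorem dvd_mod_iff (p x n : ℕ) : (p:ℤ) ∣ ((x % p : ℕ):ℤ)^2 - n ↔ (p:ℤ) ∣ (x:ℤ)^2 - n := by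
  have h : (p:ℤ) ∣ ((x:ℤ)^2 - n) - (((x % p : ℕ):ℤ)^2 - n) := by
    have : (p:ℤ) ∣ (x:ℤ) - ((x % p : ℕ):ℤ) := by
      push_cast
      exact Int.dvd_self_sub_emod
    have h2 : ((x:ℤ)^2 - n) - (((x % p : ℕ):ℤ)^2 - n) = ((x:ℤ) - ((x % p : ℕ):ℤ)) * ((x:ℤ) + ((x % p : ℕ):ℤ)) := by ring
    rw [h2]; exact Dvd.dvd.mul_right this _
  exact (dvd_iff_dvd_of_dvd_sub h).symm

theorem A2_prod (n : ℕ) (T : Finset ℕ) (hT : ∀ p ∈ T, p.Prime) :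
    A2 n (∏ p ∈ T, p) = ((∏ p ∈ T, fp p n : ℝ) : ℂ) := by
  set q := ∏ p ∈ T, p with hq
  have hq0 : 0 < q := Finset.prod_pos (fun p hp => (hT p hp).pos)
  have s1 : ∑ a ∈ (Finset.Icc 1 q).filter (fun a => Nat.gcd a q = 1),
      Sqa q a * e (-((a : ℝ) * (n : ℝ) / (q : ℝ)))
      = ∑ x ∈ (Finset.Icc 1 q).filter (fun x => Nat.gcd x q = 1), ram ((x:ℤ)^2 - n) q := by
    unfold Sqa ram
    simp only [Finset.sum_mul]
    rw [Finset.sum_comm]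
    apply Finset.sum_congr rfl; intro x _
    apply Finset.sum_congr rfl; intro a _
    rw [← e_add]
    congr 1
    push_cast
    ring
  have s2 : ∑ x ∈ (Finset.Icc 1 q).filter (fun x => Nat.gcd x q = 1), ram ((x:ℤ)^2 - n) q
      = ((∑ x ∈ Finset.Ico 1 (1 + q), ∏ p ∈ T, (if p ∣ x then 0 else cp p ((x:ℤ)^2 - n)) : ℝ) : ℂ) := by
    rw [Finset.sum_filter]
    have : Finset.Icc 1 q = Finset.Ico 1 (1+q) := by ext; simp; omega
    rw [this]
    push_cast
    apply Finset.sum_congr rfl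
    intro x _
    have hgcd : Nat.gcd x q = 1 ↔ ∀ p ∈ T, ¬ p ∣ x := by
      rw [← Nat.coprime_iff_gcd_eq_one, hq, Nat.coprime_prod_right_iff]
      apply forall₂_congr
      intro p hp
      rw [Nat.coprime_comm, (hT p hp).coprime_iff_not_dvd]
    split_ifs with hc
    · rw [hq, ram_prod _ T hT]
      push_cast
      apply Finset.prod_congr rfl
      intro p hp
      rw [if_neg (hgcd.1 hc p hp)]
    · rw [hgcd] at hc
      push Not at hc
      obtain ⟨p, hp, hpx⟩ := hc
      symm
      apply Finset.prod_eq_zero hp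
      simp [hpx]
  have hper : ∀ p ∈ T, ∀ x, (fun p (x:ℕ) => if p ∣ x then 0 else cp p ((x:ℤ)^2 - n)) p (x % p)
      = (fun p (x:ℕ) => if p ∣ x then 0 else cp p ((x:ℤ)^2 - n)) p x := by
    intro p hp x
    simp only [cp, dvd_mod_iff, Nat.dvd_mod_iff dvd_rfl]
  have s3 : ∑ x ∈ Finset.Ico 1 (1 + q), ∏ p ∈ T, (if p ∣ x then 0 else cp p ((x:ℤ)^2 - n))
      = ∏ p ∈ T, (p * nu p n - ((p:ℝ) - 1)) := by
    rw [period_sum q hq0, hq, crtT T hT _ hper]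
    · apply Finset.prod_congr rfl
      intro p hp
      have h0 : ((Finset.range p).filter (fun x => p ∣ x)).card = 1 := by
        have : (Finset.range p).filter (fun x => p ∣ x) = {0} := by
          ext x
          simp only [Finset.mem_filter, Finset.mem_range, Finset.mem_singleton]
          constructor
          · rintro ⟨h1, h2⟩; exact Nat.eq_zero_of_dvd_of_lt h2 h1
          · rintro rfl; exact ⟨(hT p hp).pos, dvd_zero _⟩
        rw [this]; simp
      have e1 : ∀ x : ℕ, (if p ∣ x then 0 else cp p ((x:ℤ)^2 - n))
        = p * (if (¬ p ∣ x ∧ (p:ℤ) ∣ (x:ℤ)^2 - n) then (1:ℝ) else 0) - 1 + (if p ∣ x then 1 else 0) := by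
        intro x
        by_cases h1 : p ∣ x <;> by_cases h2 : (p:ℤ) ∣ (x:ℤ)^2 - n <;> simp [h1, h2, cp]
      simp only [e1]
      rw [Finset.sum_add_distrib, Finset.sum_sub_distrib, ← Finset.mul_sum, Finset.sum_boole, Finset.sum_boole, h0]
      simp [nu]
      ring
    · intro x
      apply Finset.prod_congr rfl
      intro p hp
      have := hper p hp
      simp only at this
      rw [← this, Nat.mod_mod_of_dvd _ (Finset.dvd_prod_of_mem _ hp), this]
  unfold A2
  rw [s1, s2, s3, ← Complex.ofReal_mul]
  congr 1
  have hmu : ((ArithmeticFunction.moebius q : ℤ) : ℝ) = ∏ p ∈ T, (-1:ℝ) := by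
    rw [hq, ArithmeticFunction.IsMultiplicative.map_prod (fun p : ℕ => p) ArithmeticFunction.isMultiplicative_moebius T (by
      intro p hp q hq hpq
      exact (Nat.coprime_primes (hT p hp) (hT q hq)).2 hpq)]
    push_cast
    apply Finset.prod_congr rfl
    intro p hp
    rw [ArithmeticFunction.moebius_apply_prime (hT p hp)]; simp
  have hphi : (Nat.totient q : ℝ) = ∏ p ∈ T, ((p:ℝ) - 1) := by
    have : ∀ U : Finset ℕ, U ⊆ T → (Nat.totient (∏ p ∈ U, p) : ℝ) = ∏ p ∈ U, ((p:ℝ) - 1) := by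
      intro U
      induction U using Finset.induction_on with
      | empty => simp
      | insert r U hr ih =>
        intro hU
        have hrp := hT r (hU (by simp))
        rw [Finset.prod_insert hr, Finset.prod_insert hr, Nat.totient_mul, Nat.totient_prime hrp]
        · push_cast
          rw [ih (fun x hx => hU (by simp [hx])), Nat.cast_sub hrp.one_le]; simp
        · apply Nat.Coprime.prod_right
          intro p hp
          exact (Nat.coprime_primes hrp (hT p (hU (by simp [hp])))).2 (by rintro rfl; exact hr hp)
    exact this T subset_rfl
  rw [hmu, hphi, ← Finset.prod_pow, ← Finset.prod_div_distrib, ← Finset.prod_mul_distrib]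
  apply Finset.prod_congr rfl
  intro p _
  unfold fp
  ring

theorem A2_nonsq (n q : ℕ) (hq : ¬ Squarefree q) : A2 n q = 0 := by
  unfold A2
  rw [ArithmeticFunction.moebius_eq_zero_of_not_squarefree hq]
  simp

theorem SS2_eq (n : ℕ) (P : ℝ) (hP : 0 ≤ P) (S : Finset ℕ) (hS : ∀ p, p ∈ S → p.Prime)
    (hS' : ∀ p : ℕ, p.Prime → (p:ℝ) ≤ P → p ∈ S) :
    (SS2 n P).re = ∑ T ∈ S.powerset with ((∏ p ∈ T, p : ℕ):ℝ) ≤ P, ∏ p ∈ T, fp p n := by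
  have : SS2 n P = ((∑ T ∈ S.powerset with ((∏ p ∈ T, p : ℕ):ℝ) ≤ P, ∏ p ∈ T, fp p n : ℝ) : ℂ) := by
    unfold SS2
    rw [← Finset.sum_filter_of_ne (p := fun q => Squarefree q) (by
      intro q _ h
      by_contra hc
      exact h (A2_nonsq n q hc))]
    rw [Complex.ofReal_sum]
    symm
    apply Finset.sum_nbij' (fun T => ∏ p ∈ T, p) (fun q => q.primeFactors)
    · intro T hT
      simp only [Finset.mem_filter, Finset.mem_powerset, Finset.mem_Icc] at hT ⊢
      have hp : ∀ p ∈ T, p.Prime := fun p h => hS p (hT.1 h)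
      refine ⟨⟨Finset.prod_pos (fun p h => (hp p h).pos), Nat.le_floor hT.2⟩, ?_⟩
      apply Finset.squarefree_prod_of_pairwise_isCoprime
      · intro p h q h' hpq
        exact Nat.coprime_iff_isRelPrime.1 ((Nat.coprime_primes (hp p h) (hp q h')).2 hpq)
      · intro p h; exact (hp p h).squarefree
    · intro q hq
      simp only [Finset.mem_filter, Finset.mem_powerset, Finset.mem_Icc] at hq ⊢
      have hqP : (q:ℝ) ≤ P := (Nat.le_floor_iff hP).1 hq.1.2
      constructor
      · intro p hp
        have hpp := Nat.prime_of_mem_primeFactors hp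
        apply hS' p hpp
        have : p ≤ q := Nat.le_of_mem_primeFactors hp
        have : (p:ℝ) ≤ q := by exact_mod_cast this
        linarith
      · rw [Nat.prod_primeFactors_of_squarefree hq.2]; exact hqP
    · intro T hT
      simp only [Finset.mem_filter, Finset.mem_powerset] at hT
      exact Nat.primeFactors_prod (fun p h => hS p (hT.1 h))
    · intro q hq
      simp only [Finset.mem_filter] at hq
      exact Nat.prod_primeFactors_of_squarefree hq.2
    · intro T hT
      simp only [Finset.mem_filter, Finset.mem_powerset] at hT
      rw [A2_prod n T (fun p h => hS p (hT.1 h))]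
  rw [this, Complex.ofReal_re]

theorem nu_le_two (p n : ℕ) (hp : p.Prime) : nu p n ≤ 2 := by
  unfold nu
  rcases Finset.eq_empty_or_nonempty ((Finset.range p).filter (fun x => ¬ p ∣ x ∧ (p:ℤ) ∣ (x:ℤ)^2 - n)) with h | ⟨x, hx⟩
  · rw [h]; simp
  · refine (Finset.card_le_card (t := {x, p - x}) ?_).trans Finset.card_le_two
    intro y hy
    simp only [Finset.mem_filter, Finset.mem_range, Finset.mem_insert, Finset.mem_singleton] at hx hy ⊢
    have hd : (p:ℤ) ∣ ((y:ℤ) - x) * (y + x) := by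
      have := dvd_sub hy.2.2 hx.2.2
      have e : ((y:ℤ)^2 - n) - ((x:ℤ)^2 - n) = ((y:ℤ) - x) * (y + x) := by ring
      rwa [e] at this
    have hx0 : 0 < x := Nat.pos_of_ne_zero (fun h => hx.2.1 (h ▸ dvd_zero _))
    rcases (Nat.prime_iff_prime_int.1 hp).dvd_or_dvd hd with h | h
    · left
      have := Int.eq_zero_of_abs_lt_dvd h (by rw [abs_lt]; omega)
      omega
    · right
      obtain ⟨k, hk⟩ := h
      have hp0 := hp.pos
      have : k = 1 := by
        have h1 : 0 < (p:ℤ) * k := by omega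
        have h2 : (p:ℤ) * k < p * 2 := by omega
        have h3 : 0 < k := by by_contra hc; push Not at hc; nlinarith
        have h4 : k < 2 := lt_of_mul_lt_mul_left h2 (by omega)
        omega
      subst this
      omega

theorem nu_two (n : ℕ) : nu 2 n ≤ 1 := by
  unfold nu
  have : (Finset.range 2).filter (fun x : ℕ => ¬ 2 ∣ x ∧ ((2:ℕ):ℤ) ∣ (x:ℤ)^2 - n) ⊆ {1} := by
    intro x hx
    simp only [Finset.mem_filter, Finset.mem_range, Finset.mem_singleton] at hx ⊢
    omega
  simpa using Finset.card_le_card this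

theorem fp_cases (p n : ℕ) (hp : p.Prime) : (fp p n = 1 / ((p:ℝ) - 1)) ∨ (fp p n = - 1 / ((p:ℝ) - 1)^2) ∨
    (3 ≤ p ∧ fp p n = - ((p:ℝ) + 1) / ((p:ℝ) - 1)^2) := by
  have h2 := nu_le_two p n hp
  have hp2 := hp.two_le
  have hp' : (p:ℝ) - 1 ≠ 0 := by
    have : (2:ℝ) ≤ p := by exact_mod_cast hp2
    linarith
  have : nu p n = 0 ∨ nu p n = 1 ∨ nu p n = 2 := by omega
  rcases this with h | h | h
  · left; unfold fp; rw [h]; push_cast; field_simp; ring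
  · right; left; unfold fp; rw [h]; push_cast; congr 1; ring
  · right; right
    constructor
    · by_contra hc
      have : p = 2 := by omega
      subst this
      have := nu_two n
      omega
    · unfold fp; rw [h]; push_cast; congr 1; ring

theorem fp_abs3 (p n : ℕ) (hp : p.Prime) : |fp p n| ≤ 3 / p := by
  have hp2 : (2:ℝ) ≤ p := by exact_mod_cast hp.two_le
  rcases fp_cases p n hp with h | h | ⟨h3, h⟩
  · rw [h, abs_of_nonneg (by apply div_nonneg <;> linarith), div_le_div_iff₀ (by linarith) (by linarith)]
    linarith
  · rw [h, neg_div, abs_neg, abs_of_nonneg (by positivity), div_le_div_iff₀ (by nlinarith) (by linarith)]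
    nlinarith
  · have h3 : (3:ℝ) ≤ p := by exact_mod_cast h3
    rw [h, neg_div, abs_neg, abs_of_nonneg (by positivity), div_le_div_iff₀ (by nlinarith) (by linarith)]
    nlinarith

theorem fp_abs1 (p n : ℕ) (hp : p.Prime) : |fp p n| ≤ 1 := by
  have hp2 : (2:ℝ) ≤ p := by exact_mod_cast hp.two_le
  rcases fp_cases p n hp with h | h | ⟨h3, h⟩
  · rw [h, abs_of_nonneg (by apply div_nonneg <;> linarith), div_le_iff₀ (by linarith)]
    linarith
  · rw [h, neg_div, abs_neg, abs_of_nonneg (by positivity), div_le_iff₀ (by nlinarith)]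
    nlinarith
  · have h3 : (3:ℝ) ≤ p := by exact_mod_cast h3
    rw [h, neg_div, abs_neg, abs_of_nonneg (by positivity), div_le_iff₀ (by nlinarith)]
    nlinarith

theorem nu_H2 (n : ℕ) (hn : H2mem n) (p : ℕ) (hp : p.Prime) (hp5 : p < 5) : nu p n = 0 := by
  have hp2 := hp.two_le
  obtain ⟨_, h2, h3⟩ := hn
  unfold nu
  rw [Finset.card_eq_zero, Finset.filter_eq_empty_iff]
  intro x hx
  rw [Finset.mem_range] at hx
  interval_cases p
  · interval_cases x <;> simp; omega
  · interval_cases x <;> simp <;> omega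
  · exact absurd hp (by norm_num)

theorem fp_lower (n : ℕ) (hn : H2mem n) (p : ℕ) (hp : p.Prime) : (1 + 4 / (p:ℝ))⁻¹ ≤ 1 + fp p n := by
  have hp2 : (2:ℝ) ≤ p := by exact_mod_cast hp.two_le
  have hpos : (0:ℝ) < p := by linarith
  have h1 : (1 + 4 / (p:ℝ))⁻¹ ≤ 1 := by
    apply inv_le_one_of_one_le₀
    have : 0 ≤ 4 / (p:ℝ) := by positivity
    linarith
  by_cases h5 : p < 5
  · have : 0 ≤ fp p n := by
      unfold fp
      rw [nu_H2 n hn p hp h5]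
      apply div_nonneg _ (by positivity)
      push_cast; linarith
    linarith
  · have h5 : (5:ℝ) ≤ p := by exact_mod_cast not_lt.1 h5
    have h2 : -(2 / (p:ℝ)) ≤ fp p n := by
      rw [← neg_div]
      rcases fp_cases p n hp with h | h | ⟨h3, h⟩
      · rw [h]
        have : 0 ≤ 1 / ((p:ℝ) - 1) := by apply div_nonneg <;> linarith
        have : 0 ≤ 2 / (p:ℝ) := by positivity
        rw [neg_div]
        linarith
      · rw [h, div_le_div_iff₀ hpos (by nlinarith)]; nlinarith
      · rw [h, div_le_div_iff₀ hpos (by nlinarith)]; nlinarith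
    have h3 : (1 + 4 / (p:ℝ))⁻¹ ≤ 1 - 2 / p := by
      rw [inv_le_iff_one_le_mul₀ (by positivity)]
      have : (1 - 2 / (p:ℝ)) * (1 + 4 / p) = 1 + (2 * p - 8) / p^2 := by field_simp; ring
      rw [this]
      have : 0 ≤ (2 * (p:ℝ) - 8) / p^2 := by apply div_nonneg (by linarith) (by positivity)
      linarith
    linarith

theorem fp_mod (p n : ℕ) : fp p (n % p) = fp p n := by
  have : nu p (n % p) = nu p n := by
    unfold nu
    congr 1
    apply Finset.filter_congr
    intro x _
    have : (p:ℤ) ∣ (x:ℤ)^2 - ((n % p : ℕ):ℤ) ↔ (p:ℤ) ∣ (x:ℤ)^2 - n := by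
      apply dvd_iff_dvd_of_dvd_sub
      have : (x:ℤ)^2 - ((n % p : ℕ):ℤ) - ((x:ℤ)^2 - n) = n - ((n % p : ℕ):ℤ) := by ring
      rw [this]; push_cast; exact Int.dvd_self_sub_emod
    rw [this]
  unfold fp; rw [this]

theorem card_dvd_range (p : ℕ) (hp : p.Prime) : (Finset.range p).filter (fun x => p ∣ x) = {0} := by
  ext x
  simp only [Finset.mem_filter, Finset.mem_range, Finset.mem_singleton]
  constructor
  · rintro ⟨h1, h2⟩; exact Nat.eq_zero_of_dvd_of_lt h2 h1
  · rintro rfl; exact ⟨hp.pos, dvd_zero _⟩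

theorem card_ndvd_range (p : ℕ) (hp : p.Prime) : ((Finset.range p).filter (fun x => ¬ p ∣ x)).card = p - 1 := by
  have := Finset.card_filter_add_card_filter_not (s := Finset.range p) (fun x => p ∣ x)
  rw [card_dvd_range p hp] at this
  simp at this
  omega

theorem nu_sum (p : ℕ) (hp : p.Prime) : ∑ n ∈ Finset.range p, nu p n = p - 1 := by
  have : ∀ n, nu p n = ∑ x ∈ (Finset.range p).filter (fun x => ¬ p ∣ x), if (p:ℤ) ∣ (x:ℤ)^2 - n then 1 else 0 := by
    intro n
    unfold nu
    rw [← Finset.filter_filter, Finset.card_filter]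
  simp only [this]
  rw [Finset.sum_comm, ← card_ndvd_range p hp, Finset.card_eq_sum_ones]
  apply Finset.sum_congr rfl
  intro x _
  rw [← Finset.card_filter, Finset.card_eq_one]
  refine ⟨x^2 % p, ?_⟩
  ext n
  simp only [Finset.mem_filter, Finset.mem_range, Finset.mem_singleton]
  have : (p:ℤ) ∣ (x:ℤ)^2 - n ↔ n ≡ x^2 [MOD p] := by
    rw [Nat.modEq_iff_dvd]; push_cast; rfl
  rw [this]
  constructor
  · rintro ⟨h1, h2⟩
    rw [← h2, Nat.mod_eq_of_lt h1]
  · rintro rfl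
    exact ⟨Nat.mod_lt _ hp.pos, Nat.mod_modEq _ _⟩

theorem fp_sum (p : ℕ) (hp : p.Prime) : ∑ n ∈ Finset.range p, fp p n = 0 := by
  unfold fp
  rw [← Finset.sum_div, Finset.sum_sub_distrib, ← Finset.mul_sum]
  have := nu_sum p hp
  have h : ((∑ n ∈ Finset.range p, nu p n : ℕ) : ℝ) = p - 1 := by
    rw [this, Nat.cast_sub hp.one_le]; simp
  push_cast at h
  rw [h]
  simp
  left; ring

theorem sieve_w (p n r : ℕ) (hp : p.Prime) (hr : ¬ p ∣ r) :
    ((Finset.range p).filter (fun x => p ∣ x ∨ (p:ℤ) ∣ ((r * x : ℕ):ℤ)^2 - n)).card = 1 + nu p n := by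
  have hsplit := Finset.card_filter_add_card_filter_not (s := (Finset.range p).filter (fun x => p ∣ x ∨ (p:ℤ) ∣ ((r * x : ℕ):ℤ)^2 - n)) (fun x => p ∣ x)
  rw [← hsplit, Finset.filter_filter, Finset.filter_filter]
  congr 1
  · rw [show (1:ℕ) = ({0} : Finset ℕ).card by simp, ← card_dvd_range p hp]
    congr 1
    apply Finset.filter_congr
    intro x _; tauto
  · obtain ⟨u, _, hu⟩ := Nat.exists_mul_mod_eq_one_of_coprime ((hp.coprime_iff_not_dvd.2 hr).symm) hp.one_lt
    have hru : r * u ≡ 1 [MOD p] := by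
      unfold Nat.ModEq; rw [hu, Nat.mod_eq_of_lt hp.one_lt]
    have hpu : ¬ p ∣ u := by
      intro h
      have : r * u ≡ 0 [MOD p] := (Nat.modEq_zero_iff_dvd).2 (h.mul_left r)
      have := (hru.symm.trans this)
      rw [Nat.modEq_zero_iff_dvd] at this
      exact hp.one_lt.ne' (Nat.dvd_one.1 this)
    unfold nu
    apply Finset.card_nbij' (fun x => r * x % p) (fun y => u * y % p)
    · intro x hx
      simp only [Finset.coe_filter, Finset.mem_range, Set.mem_ofPred_eq] at hx ⊢
      obtain ⟨h1, h2, h3⟩ := hx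
      refine ⟨Nat.mod_lt _ hp.pos, ?_, ?_⟩
      · rw [Nat.dvd_mod_iff dvd_rfl, hp.dvd_mul]; tauto
      · rw [dvd_mod_iff]; tauto
    · intro x hx
      simp only [Finset.coe_filter, Finset.mem_range, Set.mem_ofPred_eq] at hx ⊢
      obtain ⟨h1, h2, h3⟩ := hx
      refine ⟨Nat.mod_lt _ hp.pos, Or.inr ?_, ?_⟩
      · rw [← dvd_mod_iff]
        have : r * (u * x % p) % p = x % p := by
          have e1 : r * (u * x % p) ≡ r * (u * x) [MOD p] := Nat.ModEq.mul_left _ (Nat.mod_modEq _ _)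
          have e2 : r * (u * x) ≡ 1 * x [MOD p] := by rw [← mul_assoc]; exact hru.mul_right _
          have := e1.trans e2
          rw [one_mul] at this
          exact this
        rw [this, dvd_mod_iff]; exact h3
      · rw [Nat.dvd_mod_iff dvd_rfl, hp.dvd_mul]; tauto
    · intro x hx
      simp only [Finset.coe_filter, Finset.mem_range, Set.mem_ofPred_eq] at hx
      have e1 : u * (r * x % p) ≡ u * (r * x) [MOD p] := Nat.ModEq.mul_left _ (Nat.mod_modEq _ _)
      have e2 : u * (r * x) ≡ 1 * x [MOD p] := by rw [← mul_assoc, mul_comm u r]; exact hru.mul_right _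
      have := e1.trans e2
      rw [one_mul] at this
      show u * (r * x % p) % p = x
      rw [this, Nat.mod_eq_of_lt hx.1]
    · intro x hx
      simp only [Finset.coe_filter, Finset.mem_range, Set.mem_ofPred_eq] at hx
      have e1 : r * (u * x % p) ≡ r * (u * x) [MOD p] := Nat.ModEq.mul_left _ (Nat.mod_modEq _ _)
      have e2 : r * (u * x) ≡ 1 * x [MOD p] := by rw [← mul_assoc]; exact hru.mul_right _
      have := e1.trans e2
      rw [one_mul] at this
      show r * (u * x % p) % p = x
      rw [this, Nat.mod_eq_of_lt hx.1]

theorem local_id (p n : ℕ) (hp : p.Prime) :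
    1 - ((1 + nu p n : ℕ) : ℝ) / p = (1 - 1 / (p:ℝ))^2 * (1 + fp p n) := by
  have hp2 : (2:ℝ) ≤ p := by exact_mod_cast hp.two_le
  have h1 : (p:ℝ) ≠ 0 := by linarith
  have h2 : (p:ℝ) - 1 ≠ 0 := by linarith
  unfold fp
  push_cast
  field_simp
  ring

theorem dyadic (j : ℕ) (hj : 1 ≤ j) (S : Finset ℕ) (hS : ∀ p ∈ S, p.Prime ∧ Nat.log 2 p = j) :
    ∑ p ∈ S, 1 / (p:ℝ) ≤ 4 / j := by
  have hlog2 : 0 < Real.log 2 := Real.log_pos (by norm_num)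
  have hj0 : (0:ℝ) < j := by exact_mod_cast hj
  have hb : ∀ p ∈ S, 2^j ≤ p ∧ p < 2^(j+1) := by
    intro p hp
    obtain ⟨h1, h2⟩ := hS p hp
    constructor
    · rw [← h2]; exact Nat.pow_log_le_self 2 h1.ne_zero
    · rw [← h2]; exact Nat.lt_pow_succ_log_self (by norm_num) p
  have h1 : ∑ p ∈ S, Real.log p ≤ Real.log 4 * 2^(j+1) := by
    refine le_trans ?_ (Chebyshev.theta_le_log4_mul_x (x := 2^(j+1)) (by positivity))
    rw [Chebyshev.theta_eq_sum_Icc]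
    apply Finset.sum_le_sum_of_subset_of_nonneg
    · intro p hp
      rw [Finset.mem_filter, Finset.mem_Icc]
      refine ⟨⟨Nat.zero_le _, ?_⟩, (hS p hp).1⟩
      apply Nat.le_floor
      exact_mod_cast (hb p hp).2.le
    · intro p _ _
      exact Real.log_natCast_nonneg p
  have h2 : ∀ p ∈ S, 1 / (p:ℝ) ≤ Real.log p * (1 / (2^j * (j * Real.log 2))) := by
    intro p hp
    have hp1 : (2:ℝ)^j ≤ p := by exact_mod_cast (hb p hp).1
    have hl : j * Real.log 2 ≤ Real.log p := by
      rw [← Real.log_pow]; exact Real.log_le_log (by positivity) hp1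
    have hpp : (0:ℝ) < p := lt_of_lt_of_le (by positivity) hp1
    rw [mul_one_div, div_le_div_iff₀ hpp (by positivity), one_mul, mul_comm]
    gcongr
  refine (Finset.sum_le_sum h2).trans ?_
  rw [← Finset.sum_mul]
  have h4 : Real.log 4 = 2 * Real.log 2 := by
    rw [show (4:ℝ) = 2^2 by norm_num, Real.log_pow]; norm_num
  calc _ ≤ (Real.log 4 * 2^(j+1)) * (1 / (2^j * (j * Real.log 2))) := by gcongr
    _ = 4 / j := by rw [h4, pow_succ]; field_simp; norm_num

theorem dyadic_sum (S J : Finset ℕ) (hS : ∀ p ∈ S, p.Prime ∧ Nat.log 2 p ∈ J) (hJ : ∀ j ∈ J, 1 ≤ j) :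
    ∑ p ∈ S, 1 / (p:ℝ) ≤ ∑ j ∈ J, 4 / (j:ℝ) := by
  rw [← Finset.sum_fiberwise_of_maps_to (g := Nat.log 2) (t := J) (fun p hp => (hS p hp).2)]
  apply Finset.sum_le_sum
  intro j hj
  apply dyadic j (hJ j hj)
  intro p hp
  rw [Finset.mem_filter] at hp
  exact ⟨(hS p hp.1).1, hp.2⟩

theorem mertens1 (Z : ℕ) (L : ℝ) (hL : 1 ≤ L) (hZ : (Nat.log 2 Z : ℝ) ≤ L) :
    ∑ p ∈ (Z+1).primesBelow, 1 / (p:ℝ) ≤ 4 + 4 * Real.log L := by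
  refine (dyadic_sum _ (Finset.Icc 1 (Nat.log 2 Z)) ?_ ?_).trans ?_
  · intro p hp
    rw [Nat.mem_primesBelow] at hp
    refine ⟨hp.2, ?_⟩
    rw [Finset.mem_Icc]
    exact ⟨Nat.log_pos (by norm_num) hp.2.two_le, Nat.log_mono_right (by omega)⟩
  · intro j hj; exact (Finset.mem_Icc.1 hj).1
  · have h := harmonic_le_one_add_log (Nat.log 2 Z)
    rw [harmonic_eq_sum_Icc] at h
    push_cast at h
    have : ∑ j ∈ Finset.Icc 1 (Nat.log 2 Z), 4 / (j:ℝ) = 4 * ∑ j ∈ Finset.Icc 1 (Nat.log 2 Z), (j:ℝ)⁻¹ := by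
      rw [Finset.mul_sum]; rfl
    rw [this]
    have hl : Real.log (Nat.log 2 Z) ≤ Real.log L := by
      rcases Nat.eq_zero_or_pos (Nat.log 2 Z) with h0 | h0
      · rw [h0]; simp [Real.log_nonneg hL]
      · exact Real.log_le_log (by exact_mod_cast h0) hZ
    linarith

theorem mertens_prod (Z : ℕ) (L : ℝ) (hL : 1 ≤ L) (hZ : (Nat.log 2 Z : ℝ) ≤ L) (κ : ℝ) (hκ : 0 ≤ κ) :
    ∏ p ∈ (Z+1).primesBelow, (1 + κ / (p:ℝ)) ≤ Real.exp (4 * κ) * L ^ (4 * κ) := by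
  have h1 : ∏ p ∈ (Z+1).primesBelow, (1 + κ / (p:ℝ)) ≤ ∏ p ∈ (Z+1).primesBelow, Real.exp (κ * (1 / (p:ℝ))) := by
    apply Finset.prod_le_prod
    · intro p _; positivity
    · intro p _
      have := Real.add_one_le_exp (κ * (1 / (p:ℝ)))
      rw [mul_one_div] at *
      linarith
  refine h1.trans ?_
  rw [← Real.exp_sum, ← Finset.mul_sum, Real.rpow_def_of_pos (by linarith), ← Real.exp_add]
  apply Real.exp_le_exp.2
  have := mul_le_mul_of_nonneg_left (mertens1 Z L hL hZ) hκ
  linarith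

theorem recip_range (u v : ℝ) (hu : 4 ≤ u) (huv : u ≤ v) (S : Finset ℕ)
    (hS : ∀ p ∈ S, p.Prime ∧ u ≤ p ∧ (p:ℝ) ≤ v) :
    ∑ p ∈ S, 1 / (p:ℝ) ≤ 8 * (Real.log v - Real.log u + 2) / Real.log u := by
  have hlog2 : 0 < Real.log 2 := Real.log_pos (by norm_num)
  have hlog21 : Real.log 2 ≤ 1 := by have := Real.log_two_lt_d9; linarith
  have hlu : 2 * Real.log 2 ≤ Real.log u := by
    have : Real.log ((2:ℝ)^2) ≤ Real.log u := Real.log_le_log (by norm_num) (by linarith)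
    rw [Real.log_pow] at this
    exact_mod_cast this
  have hluv : Real.log u ≤ Real.log v := Real.log_le_log (by linarith) huv
  set α := Real.log u / Real.log 2 - 1 with hα
  set β := Real.log v / Real.log 2 with hβ
  have hα2 : Real.log u / (2 * Real.log 2) ≤ α := by
    rw [hα, div_le_iff₀ (by positivity)]
    have : (Real.log u / Real.log 2 - 1) * (2 * Real.log 2) = 2 * Real.log u - 2 * Real.log 2 := by field_simp
    linarith
  have hα1 : 1 ≤ α := by
    refine le_trans ?_ hα2
    rw [le_div_iff₀ (by positivity)]; linarith
  refine (dyadic_sum S (Finset.Icc ⌈α⌉₊ ⌊β⌋₊) ?_ ?_).trans ?_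
  · intro p hp
    obtain ⟨h1, h2, h3⟩ := hS p hp
    refine ⟨h1, ?_⟩
    have hp0 : (0:ℝ) < p := by exact_mod_cast h1.pos
    rw [Finset.mem_Icc]
    constructor
    · apply Nat.ceil_le.2
      rw [hα, sub_le_iff_le_add, div_le_iff₀ hlog2]
      have : (p:ℝ) ≤ 2^(Nat.log 2 p + 1) := by exact_mod_cast (Nat.lt_pow_succ_log_self (by norm_num) p).le
      have := Real.log_le_log hp0 this
      rw [Real.log_pow] at this
      have h4 := Real.log_le_log (by linarith) h2
      push_cast at this
      linarith
    · apply Nat.le_floor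
      rw [hβ, le_div_iff₀ hlog2, ← Real.log_pow]
      have : ((2:ℝ)^(Nat.log 2 p)) ≤ p := by exact_mod_cast Nat.pow_log_le_self 2 h1.ne_zero
      exact Real.log_le_log (by positivity) (this.trans h3)
  · intro j hj
    have := Nat.ceil_le.1 (Finset.mem_Icc.1 hj).1
    have : (1:ℝ) ≤ j := hα1.trans this
    exact_mod_cast this
  · have hle : ∀ j ∈ Finset.Icc ⌈α⌉₊ ⌊β⌋₊, 4 / (j:ℝ) ≤ 4 / (Real.log u / (2 * Real.log 2)) := by
      intro j hj
      have := Nat.ceil_le.1 (Finset.mem_Icc.1 hj).1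
      gcongr
      · apply div_pos <;> linarith
      · linarith
    refine (Finset.sum_le_sum hle).trans ?_
    rw [Finset.sum_const, nsmul_eq_mul, Nat.card_Icc]
    have hβα : β - α + 1 = (Real.log v - Real.log u) / Real.log 2 + 2 := by rw [hβ, hα]; ring
    have hnn : 0 ≤ (Real.log v - Real.log u) / Real.log 2 := div_nonneg (by linarith) hlog2.le
    have hc : ((⌊β⌋₊ + 1 - ⌈α⌉₊ : ℕ) : ℝ) ≤ (Real.log v - Real.log u) / Real.log 2 + 2 := by
      rw [← hβα]
      rcases le_total ⌈α⌉₊ (⌊β⌋₊ + 1) with h | h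
      · rw [Nat.cast_sub h]
        have h1 := Nat.floor_le (show 0 ≤ β by linarith)
        have h2 := Nat.le_ceil α
        push_cast
        linarith
      · rw [Nat.sub_eq_zero_of_le h]
        push_cast; linarith
    have hlu0 : 0 < Real.log u := by linarith
    calc _ ≤ ((Real.log v - Real.log u) / Real.log 2 + 2) * (4 / (Real.log u / (2 * Real.log 2))) := by
          gcongr
      _ = 8 * (Real.log v - Real.log u + 2 * Real.log 2) / Real.log u := by field_simp; ring
      _ ≤ _ := by gcongr; linarith

theorem mertens3 (Z : ℕ) (hZ : 1 ≤ Z) :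
    ∏ p ∈ (Z+1).primesBelow, (1 - 1 / (p:ℝ)) ≤ 1 / Real.log (Z + 1) := by
  let f : ℕ →* ℝ := ⟨⟨fun n => (n:ℝ)⁻¹, by simp⟩, by intro a b; push_cast; rw [mul_inv]⟩
  have hf : ∀ n, f n = (n:ℝ)⁻¹ := fun n => rfl
  have h := EulerProduct.summable_and_hasSum_smoothNumbers_prod_primesBelow_geometric (f := f)
    (by
      intro p hp
      rw [hf, norm_inv, Real.norm_natCast]
      apply inv_lt_one_of_one_lt₀
      exact_mod_cast hp.one_lt) (Z+1)
  have hs := h.2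
  have hle : (harmonic Z : ℝ) ≤ ∏ p ∈ (Z+1).primesBelow, (1 - f p)⁻¹ := by
    rw [harmonic_eq_sum_Icc]
    push_cast
    have hinj : ∀ i ∈ Finset.Icc 1 Z, i ∈ Nat.smoothNumbers (Z+1) := by
      intro i hi
      rw [Finset.mem_Icc] at hi
      rw [Nat.mem_smoothNumbers']
      intro p hp hpi
      have := Nat.le_of_dvd (by omega) hpi
      omega
    have := sum_le_hasSum ((Finset.Icc 1 Z).subtype (fun i => i ∈ Nat.smoothNumbers (Z+1))) (fun i _ => by rw [hf]; positivity) hs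
    refine le_trans (le_of_eq ?_) this
    rw [Finset.sum_subtype_eq_sum_filter (f := fun i => f i)]
    rw [Finset.filter_true_of_mem hinj]
    rfl
  have hlog := log_add_one_le_harmonic Z
  have hl0 : 0 < Real.log (Z+1) := Real.log_pos (by have : (1:ℝ) ≤ Z := by exact_mod_cast hZ
                                                    linarith)
  push_cast at hlog
  have h3 : Real.log (Z+1) ≤ (∏ p ∈ (Z+1).primesBelow, (1 - 1 / (p:ℝ)))⁻¹ := by
    rw [← Finset.prod_inv_distrib]
    simp only [hf] at hle
    simp only [one_div]
    exact hlog.trans hle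
  rw [one_div]
  exact (le_inv_comm₀ hl0 (inv_pos.1 (hl0.trans_le h3))).1 h3

def bigE (S : Finset ℕ) (b : ℕ) (P : ℝ) (n : ℕ) : ℝ :=
  ∑ T ∈ S.powerset with (T.card ≤ 2*b ∧ P < ((∏ p ∈ T, p : ℕ) : ℝ)), ∏ p ∈ T, fp p n

def PiS (S : Finset ℕ) (n : ℕ) : ℝ := ∏ p ∈ S, (1 + fp p n)

theorem SS2_lower (n Z b : ℕ) (P : ℝ) (hP : 0 ≤ P) (hPZ : P ≤ Z)
    (hE : |bigE (Z+1).primesBelow b P n| ≤ PiS (Z+1).primesBelow n / 4)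
    (ht : (1/2:ℝ)^(2*b) * ∏ p ∈ (Z+1).primesBelow, (1 + 6/(p:ℝ)) ≤ PiS (Z+1).primesBelow n / 4) :
    PiS (Z+1).primesBelow n / 2 ≤ (SS2 n P).re := by
  set S := (Z+1).primesBelow with hSdef
  have hpr : ∀ p, p ∈ S → p.Prime := fun p hp => Nat.prime_of_mem_primesBelow hp
  rw [SS2_eq n P hP S hpr]
  swap
  · intro p hp hpP
    rw [hSdef, Nat.mem_primesBelow]
    refine ⟨?_, hp⟩
    have : (p:ℝ) ≤ Z := hpP.trans hPZ
    have : p ≤ Z := by exact_mod_cast this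
    omega
  have h1 : PiS S n = ∑ T ∈ S.powerset, ∏ p ∈ T, fp p n := by
    unfold PiS; rw [Finset.prod_one_add]
  have h2 : ∑ T ∈ S.powerset, ∏ p ∈ T, fp p n
      = (∑ T ∈ S.powerset with ((∏ p∈T,p : ℕ):ℝ) ≤ P, ∏ p ∈ T, fp p n)
        + (bigE S b P n + ∑ T ∈ (S.powerset.filter (fun T => ¬ ((∏ p∈T,p : ℕ):ℝ) ≤ P)).filter (fun T => ¬ T.card ≤ 2*b), ∏ p ∈ T, fp p n) := by
    rw [← Finset.sum_filter_add_sum_filter_not S.powerset (fun T => ((∏ p∈T,p : ℕ):ℝ) ≤ P)]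
    congr 1
    rw [← Finset.sum_filter_add_sum_filter_not (S.powerset.filter (fun T => ¬ ((∏ p∈T,p : ℕ):ℝ) ≤ P)) (fun T => T.card ≤ 2*b)]
    congr 1
    unfold bigE
    rw [Finset.filter_filter]
    apply Finset.sum_congr _ (fun _ _ => rfl)
    apply Finset.filter_congr
    intro T _
    rw [not_le, and_comm]
  have h3 : |∑ T ∈ (S.powerset.filter (fun T => ¬ ((∏ p∈T,p : ℕ):ℝ) ≤ P)).filter (fun T => ¬ T.card ≤ 2*b), ∏ p ∈ T, fp p n|
      ≤ (1/2:ℝ)^(2*b) * ∏ p ∈ S, (1 + 6/(p:ℝ)) := by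
    calc _ ≤ ∑ T ∈ (S.powerset.filter (fun T => ¬ ((∏ p∈T,p : ℕ):ℝ) ≤ P)).filter (fun T => ¬ T.card ≤ 2*b), |∏ p ∈ T, fp p n| := Finset.abs_sum_le_sum_abs _ _
      _ ≤ ∑ T ∈ (S.powerset.filter (fun T => ¬ ((∏ p∈T,p : ℕ):ℝ) ≤ P)).filter (fun T => ¬ T.card ≤ 2*b), ∏ p ∈ T, (3/(p:ℝ)) := by
          apply Finset.sum_le_sum
          intro T hT
          rw [Finset.abs_prod]
          apply Finset.prod_le_prod (fun _ _ => abs_nonneg _)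
          intro p hp
          have : T ⊆ S := by
            simp only [Finset.mem_filter, Finset.mem_powerset] at hT
            exact hT.1.1
          exact fp_abs3 p n (hpr p (this hp))
      _ ≤ ∑ T ∈ S.powerset with 2*b < T.card, ∏ p ∈ T, (3/(p:ℝ)) := by
          apply Finset.sum_le_sum_of_subset_of_nonneg
          · intro T hT
            simp only [Finset.mem_filter, not_le] at hT ⊢
            exact ⟨hT.1.1, hT.2⟩
          · intro T _ _
            exact Finset.prod_nonneg (fun p _ => by positivity)
      _ ≤ _ := by
          have := tail_bd S (2*b) (fun p => 3/(p:ℝ)) (fun p _ => by positivity)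
          refine this.trans (le_of_eq ?_)
          congr 1
          apply Finset.prod_congr rfl
          intro p _
          ring
  have := abs_le.1 hE
  have h4 := abs_le.1 h3
  rw [h2] at h1
  linarith [this.2, h4.2]

theorem exc_bd (Z b Q : ℕ) (P lam : ℝ) (hP : 0 < P) (hl : 0 < lam) (hQ : Z^(2*b) ≤ Q) (hZ : 1 ≤ Z)
    (a h : ℕ) :
    (((Finset.Ico a (a+h)).filter (fun n => lam < |bigE (Z+1).primesBelow b P n|)).card : ℝ)
      * lam^2 ≤ h * (P⁻¹ * ∏ p ∈ (Z+1).primesBelow, (1+9/(p:ℝ))) + 2 * (Q:ℝ)^4 := by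
  set S := (Z+1).primesBelow with hSdef
  have hpr : ∀ p ∈ S, p.Prime := fun p hp => Nat.prime_of_mem_primesBelow hp
  set 𝒯 := S.powerset.filter (fun T => T.card ≤ 2*b ∧ P < ((∏ p ∈ T, p : ℕ) : ℝ)) with h𝒯
  have hsub : 𝒯 ⊆ S.powerset := Finset.filter_subset _ _
  have hv := variance_bd S hpr fp (fun p hp x => fp_mod p x)
    (fun p hp x => fp_abs1 p x (hpr p hp)) (fun p hp x => fp_abs3 p x (hpr p hp))
    (fun p hp => fp_sum p (hpr p hp)) 𝒯 hsub Q (by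
      intro T hT
      have hT' := hsub hT
      rw [Finset.mem_powerset] at hT'
      have hc : T.card ≤ 2*b := (Finset.mem_filter.1 hT).2.1
      calc ∏ p ∈ T, p ≤ ∏ p ∈ T, Z := by
            apply Finset.prod_le_prod' 
            intro p hp
            have := hT' hp
            rw [hSdef, Nat.mem_primesBelow] at this
            omega
        _ = Z^T.card := by simp
        _ ≤ Z^(2*b) := Nat.pow_le_pow_right hZ hc
        _ ≤ Q := hQ) a h
  have hv2 := variance_bd2 S 𝒯 hsub P hP (fun T hT => (Finset.mem_filter.1 hT).2.2)
  have h1 : (((Finset.Ico a (a+h)).filter (fun n => lam < |bigE S b P n|)).card : ℝ) * lam^2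
     ≤ ∑ n ∈ Finset.Ico a (a+h), (∑ T ∈ 𝒯, ∏ p ∈ T, fp p n)^2 := by
    calc _ = ∑ n ∈ (Finset.Ico a (a+h)).filter (fun n => lam < |bigE S b P n|), lam^2 := by simp
      _ ≤ ∑ n ∈ (Finset.Ico a (a+h)).filter (fun n => lam < |bigE S b P n|), (∑ T ∈ 𝒯, ∏ p ∈ T, fp p n)^2 := by
          apply Finset.sum_le_sum
          intro n hn
          have := (Finset.mem_filter.1 hn).2
          rw [← sq_abs (∑ T ∈ 𝒯, ∏ p ∈ T, fp p n)]
          exact pow_le_pow_left₀ hl.le this.le 2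
      _ ≤ _ := Finset.sum_le_sum_of_subset_of_nonneg (Finset.filter_subset _ _)
          (fun _ _ _ => sq_nonneg _)
  have : (h:ℝ) * ∑ T ∈ 𝒯, ∏ p ∈ T, (9/(p:ℝ)^2) ≤ h * (P⁻¹ * ∏ p ∈ S, (1+9/(p:ℝ))) :=
    mul_le_mul_of_nonneg_left hv2 (by positivity)
  linarith

theorem sieve_r (n Z b Q r : ℕ) (hQ : Z^(2*b) ≤ Q) (hZ : 1 ≤ Z)
    (hr : ∀ p ∈ (Z+1).primesBelow, ¬ p ∣ r) (a h : ℕ) (hPi : 0 ≤ PiS (Z+1).primesBelow n) :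
    (((Finset.Ico a (a+h)).filter (fun x => ∀ p ∈ (Z+1).primesBelow,
      ¬ (p ∣ x ∨ (p:ℤ) ∣ ((r*x:ℕ):ℤ)^2 - n))).card : ℝ)
    ≤ h * (PiS (Z+1).primesBelow n * (1/Real.log (Z+1))^2
        + (1/2)^(2*b) * ∏ p ∈ (Z+1).primesBelow, (1 + 6/(p:ℝ))) + 2*(Q:ℝ)^2 := by
  set S := (Z+1).primesBelow with hSdef
  have hpr : ∀ p ∈ S, p.Prime := fun p hp => Nat.prime_of_mem_primesBelow hp
  have hs := sieve_bd S hpr (fun p x => p ∣ x ∨ (p:ℤ) ∣ ((r*x:ℕ):ℤ)^2 - n)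
    (by
      intro p hp x
      have e1 : p ∣ x % p ↔ p ∣ x := Nat.dvd_mod_iff (dvd_refl p)
      have e2 : (p:ℤ) ∣ ((r*(x%p):ℕ):ℤ)^2 - n ↔ (p:ℤ) ∣ ((r*x:ℕ):ℤ)^2 - n := by
        rw [← dvd_mod_iff p (r*(x%p)) n, ← dvd_mod_iff p (r*x) n]
        have : r * (x % p) % p = r * x % p := by simp [Nat.mul_mod]
        rw [this]
      simp only [e1, e2])
    (fun p => ((1 + nu p n : ℕ):ℝ))
    (by
      intro p hp
      have := sieve_w p n r (hpr p hp) (hr p hp)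
      rw [← this]; congr!)
    b Q
    (by
      intro T hT hc
      calc ∏ p ∈ T, p ≤ ∏ p ∈ T, Z := by
            apply Finset.prod_le_prod' 
            intro p hp
            have := hT hp
            rw [hSdef, Nat.mem_primesBelow] at this
            omega
        _ = Z^T.card := by simp
        _ ≤ Z^(2*b) := Nat.pow_le_pow_right hZ hc
        _ ≤ Q := hQ) a h
  refine le_trans (le_of_eq ?_) (hs.trans ?_)
  · congr!
  have hA : ∏ p ∈ S, (1 - ((1 + nu p n : ℕ):ℝ)/p) ≤ PiS S n * (1/Real.log (Z+1))^2 := by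
    have : ∏ p ∈ S, (1 - ((1 + nu p n : ℕ):ℝ)/p) = PiS S n * (∏ p ∈ S, (1 - 1/(p:ℝ)))^2 := by
      unfold PiS
      rw [← Finset.prod_pow, ← Finset.prod_mul_distrib]
      apply Finset.prod_congr rfl
      intro p hp
      rw [local_id p n (hpr p hp)]; ring
    rw [this]
    apply mul_le_mul_of_nonneg_left _ hPi
    apply pow_le_pow_left₀ _ (mertens3 Z hZ)
    apply Finset.prod_nonneg
    intro p hp
    have : (1:ℝ) ≤ p := by exact_mod_cast (hpr p hp).one_lt.le
    rw [sub_nonneg, div_le_one (by linarith)]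
    exact this
  have hB : ∏ p ∈ S, (1 + 2*(((1 + nu p n : ℕ):ℝ)/p)) ≤ ∏ p ∈ S, (1 + 6/(p:ℝ)) := by
    apply Finset.prod_le_prod (fun p _ => by positivity)
    intro p hp
    have h2 : ((nu p n:ℕ):ℝ) ≤ 2 := by exact_mod_cast nu_le_two p n (hpr p hp)
    have : (0:ℝ) < p := by exact_mod_cast (hpr p hp).pos
    rw [← mul_div_assoc]
    push_cast
    gcongr
    linarith
  have hC : (1/2:ℝ)^(2*b) * ∏ p ∈ S, (1 + 2*(((1 + nu p n : ℕ):ℝ)/p)) ≤ (1/2:ℝ)^(2*b) * ∏ p ∈ S, (1 + 6/(p:ℝ)) :=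
    mul_le_mul_of_nonneg_left hB (by positivity)
  gcongr

def Vs (n Z b : ℕ) : ℝ := PiS (Z+1).primesBelow n * (1/Real.log (Z+1))^2
        + (1/2)^(2*b) * ∏ p ∈ (Z+1).primesBelow, (1 + 6/(p:ℝ))

theorem R0_bd (X Y z₀ : ℝ) (n Z b Q : ℕ) (hQ : Z^(2*b) ≤ Q) (hZ : 1 ≤ Z)
    (hzZ : (Z:ℝ) ≤ z₀) (hXZ : (Z:ℝ) < X - Y) (hY : 0 < Y) (hY2 : 2 ≤ Y^(1/4:ℝ))
    (hPi : 0 ≤ PiS (Z+1).primesBelow n) (σ : ℝ)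
    (hσ : ∀ R : Finset ℕ, (∀ p ∈ R, p.Prime ∧ z₀ ≤ p ∧ (p:ℝ) ≤ Y^(1/4:ℝ)) → ∑ p ∈ R, 1/(p:ℝ) ≤ σ) :
    (R0cnt X Y z₀ n : ℝ) ≤ √Y * σ * Vs n Z b + Y^(1/4:ℝ) * (2 * (Q:ℝ)^2) := by
  set y := Y^(1/4:ℝ) with hy
  have hyy : √Y = y * y := by
    rw [hy, ← Real.rpow_add hY, Real.sqrt_eq_rpow]; norm_num
  have hV : 0 ≤ Vs n Z b := by
    unfold Vs
    have : (0:ℝ) ≤ ∏ p ∈ (Z+1).primesBelow, (1 + 6/(p:ℝ)) := Finset.prod_nonneg (fun p _ => by positivity)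
    positivity
  have hz1 : 1 ≤ z₀ := le_trans (by exact_mod_cast hZ) hzZ
  set R : Finset ℕ := (Finset.Icc 1 ⌊y⌋₊).filter (fun p => p.Prime ∧ z₀ < (p:ℝ)) with hR
  have hRm : ∀ p, p ∈ R ↔ p.Prime ∧ z₀ < (p:ℝ) ∧ (p:ℝ) ≤ y := by
    intro p
    rw [hR, Finset.mem_filter, Finset.mem_Icc, Nat.le_floor_iff (by linarith)]
    constructor
    · rintro ⟨⟨h1,h2⟩,h3,h4⟩; exact ⟨h3,h4,h2⟩
    · rintro ⟨h3,h4,h2⟩; exact ⟨⟨h3.one_lt.le,h2⟩,h3,h4⟩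
  let al : ℕ → ℕ := fun r => ⌈√Y/(2*r)⌉₊
  let hl : ℕ → ℕ := fun r => ⌊√Y/(2*r)⌋₊ + 1
  let F : ℕ → Finset ℕ := fun r => (Finset.Ico (al r) (al r + hl r)).filter (fun x => ∀ p ∈ (Z+1).primesBelow,
      ¬ (p ∣ x ∨ (p:ℤ) ∣ ((r*x:ℕ):ℤ)^2 - n))
  have hcard : R0cnt X Y z₀ n ≤ (R.sigma F).card := by
    unfold R0cnt
    have hcc : (R.sigma F).card = Nat.card {x // x ∈ R.sigma F} := by
      rw [Nat.card_eq_fintype_card, Fintype.card_coe]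
    rw [hcc]
    refine Nat.card_le_card_of_injective (fun q => (⟨⟨q.1.2.1, q.1.2.2⟩, ?_⟩ : {x // x ∈ R.sigma F})) ?_
    · obtain ⟨⟨p1,p2,p3⟩, h1, h2, h3, h4, h5, h6, h7, h8, h9⟩ := q
      simp only at h1 h2 h3 h4 h5 h6 h7 h8 h9 ⊢
      rw [Finset.mem_sigma]
      refine ⟨(hRm p2).2 ⟨h2,h6,h7⟩, ?_⟩
      have hp2 : (0:ℝ) < p2 := by linarith
      simp only [F, Finset.mem_filter, Finset.mem_Ico]
      obtain ⟨h91, h92⟩ := h9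
      push_cast at h91 h92
      refine ⟨⟨?_, ?_⟩, ?_⟩
      · apply Nat.ceil_le.2
        rw [div_le_iff₀ (by positivity)]
        linarith
      · have e1 : √Y/(2*p2) ≤ al p2 := Nat.le_ceil _
        have e2 : √Y/(2*p2) < hl p2 := by
          simp only [hl]; push_cast; exact Nat.lt_floor_add_one _
        have e3 : (p3:ℝ) < √Y/(2*p2) + √Y/(2*p2) := by
          have : √Y/(2*p2) + √Y/(2*p2) = √Y/p2 := by field_simp; ring
          rw [this, lt_div_iff₀ hp2]; linarith
        have : (p3:ℝ) < ((al p2 + hl p2 : ℕ):ℝ) := by push_cast; linarith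
        exact_mod_cast this
      · intro p hp
        rw [Nat.mem_primesBelow] at hp
        have hpZ : p ≤ Z := by omega
        have hpZ' : (p:ℝ) ≤ Z := by exact_mod_cast hpZ
        rintro (hd | hd)
        · rw [Nat.prime_dvd_prime_iff_eq hp.2 h3] at hd
          have : (p2:ℝ) ≤ p3 := by exact_mod_cast h8
          rw [← hd] at this
          linarith
        · have : (((p2*p3:ℕ):ℤ)^2 - n) = -(p1:ℤ) := by
            rw [← h4]; push_cast; ring
          rw [this, dvd_neg, Int.natCast_dvd_natCast, Nat.prime_dvd_prime_iff_eq hp.2 h1] at hd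
          have := h5.1
          rw [← hd] at this
          linarith
    · rintro ⟨⟨p1,p2,p3⟩, h⟩ ⟨⟨q1,q2,q3⟩, h'⟩ heq
      simp only [Subtype.mk.injEq, Sigma.mk.injEq, heq_eq_eq] at heq
      obtain ⟨e1, e2⟩ := heq
      subst e1; subst e2
      have a1 := h.2.2.2.1
      have a2 := h'.2.2.2.1
      simp only at a1 a2
      have : p1 = q1 := by omega
      subst this; rfl
  have hF : ∀ r ∈ R, ((F r).card : ℝ) ≤ √Y * Vs n Z b * (1/(r:ℝ)) + 2*(Q:ℝ)^2 := by
    intro r hr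
    obtain ⟨r1, r2, r3⟩ := (hRm r).1 hr
    have hr0 : (0:ℝ) < r := by linarith
    have := sieve_r n Z b Q r hQ hZ (by
      intro p hp hd
      rw [Nat.mem_primesBelow] at hp
      rw [Nat.prime_dvd_prime_iff_eq hp.2 r1] at hd
      have : p ≤ Z := by omega
      have : (p:ℝ) ≤ Z := by exact_mod_cast this
      rw [hd] at this
      linarith) (al r) (hl r) hPi
    refine this.trans ?_
    have hh : (hl r : ℝ) ≤ √Y * (1/(r:ℝ)) := by
      have e2 : (⌊√Y/(2*r)⌋₊ : ℝ) ≤ √Y/(2*r) := Nat.floor_le (by positivity)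
      have e4 : 1 ≤ √Y/(2*r) := by
        rw [le_div_iff₀ (by positivity), hyy]; nlinarith
      have : √Y/(2*r) + √Y/(2*r) = √Y*(1/r) := by field_simp; ring
      simp only [hl]; push_cast; linarith
    have := mul_le_mul_of_nonneg_right hh hV
    unfold Vs at this ⊢
    linarith
  have hRc : (R.card : ℝ) ≤ y := by
    have : R.card ≤ ⌊y⌋₊ := by
      refine (Finset.card_filter_le _ _).trans ?_
      simp
    exact le_trans (by exact_mod_cast this) (Nat.floor_le (by linarith))
  calc (R0cnt X Y z₀ n : ℝ) ≤ ((R.sigma F).card : ℝ) := by exact_mod_cast hcard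
    _ = ∑ r ∈ R, ((F r).card : ℝ) := by rw [Finset.card_sigma]; push_cast; rfl
    _ ≤ ∑ r ∈ R, (√Y * Vs n Z b * (1/(r:ℝ)) + 2*(Q:ℝ)^2) := Finset.sum_le_sum hF
    _ = √Y * Vs n Z b * (∑ r ∈ R, 1/(r:ℝ)) + R.card * (2*(Q:ℝ)^2) := by
        rw [Finset.sum_add_distrib, ← Finset.mul_sum]; simp
    _ ≤ √Y * Vs n Z b * σ + y * (2*(Q:ℝ)^2) := by
        gcongr
        apply hσ
        intro p hp
        obtain ⟨h1,h2,h3⟩ := (hRm p).1 hp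
        exact ⟨h1, h2.le, h3⟩
    _ = _ := by ring

theorem r2_lower (X Y H : ℝ) (n : ℕ) (hY : 16 ≤ Y) (hXY : Y + 2 ≤ X) (hH : H < Y/4) (h1 : X < n) (h2 : n ≤ X + H) :
    √Y / (4 * Real.log X ^ 2) ≤ r2 X Y n := by
  set s := √Y with hs
  have hs2 : s * s = Y := Real.mul_self_sqrt (by linarith)
  have hs4 : 4 ≤ s := by
    rw [hs]; apply Real.le_sqrt_of_sq_le; linarith
  have hsX : s ≤ X := by nlinarith
  have hL : 0 < Real.log X := Real.log_pos (by linarith)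
  have hd : ∀ m : ℕ, inI1 X Y m → 0 < Real.log m ∧ Real.log m ≤ Real.log X := by
    rintro m ⟨a, b⟩
    exact ⟨Real.log_pos (by linarith), Real.log_le_log (by linarith) b.le⟩
  have hd2 : ∀ m : ℕ, inI2 Y m → 0 < Real.log m ∧ Real.log m ≤ Real.log X := by
    rintro m ⟨a, b⟩
    exact ⟨Real.log_pos (by linarith), Real.log_le_log (by linarith) (by linarith)⟩
  let G : Finset ℕ := Finset.Ico ⌈s/2⌉₊ ⌈s⌉₊
  have hG : ∀ m ∈ G, inI2 Y m := by
    intro m hm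
    simp only [G, Finset.mem_Ico] at hm
    exact ⟨Nat.ceil_le.1 hm.1, Nat.lt_ceil.1 hm.2⟩
  have hGc : s/4 ≤ G.card := by
    simp only [G, Nat.card_Ico]
    have e1 : (⌈s/2⌉₊:ℝ) < s/2 + 1 := Nat.ceil_lt_add_one (by linarith)
    have e2 : s ≤ ⌈s⌉₊ := Nat.le_ceil _
    have e3 : ⌈s/2⌉₊ ≤ ⌈s⌉₊ := Nat.ceil_le_ceil (by linarith)
    rw [Nat.cast_sub e3]
    linarith
  unfold r2
  have hmsq : ∀ m ∈ G, m^2 < n ∧ inI1 X Y (n - m^2) := by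
    intro m hm
    obtain ⟨a, b⟩ := hG m hm
    have e1 : (m:ℝ)^2 < Y := by rw [← hs2]; nlinarith
    have e2 : Y/4 ≤ (m:ℝ)^2 := by rw [← hs2]; nlinarith
    have e3 : ((m^2:ℕ):ℝ) < n := by push_cast; linarith
    have e4 : m^2 < n := by exact_mod_cast e3
    refine ⟨e4, ?_, ?_⟩
    · rw [Nat.cast_sub e4.le]; push_cast; linarith
    · rw [Nat.cast_sub e4.le]; push_cast; linarith
  have hinj : Set.InjOn (fun m : ℕ => (n - m^2, m)) G := by
    intro a _ b _ hab
    simp only [Prod.mk.injEq] at hab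
    exact hab.2
  calc s / (4 * Real.log X ^ 2) = s/4 * (1/(Real.log X * Real.log X)) := by field_simp
    _ ≤ G.card * (1/(Real.log X * Real.log X)) := by gcongr
    _ = ∑ m ∈ G.image (fun m : ℕ => (n - m^2, m)), 1/(Real.log X * Real.log X) := by
        rw [Finset.sum_const, Finset.card_image_of_injOn hinj]; simp
    _ ≤ ∑ m ∈ G.image (fun m : ℕ => (n - m^2, m)), (if m.1 + m.2 ^ 2 = n ∧ inI1 X Y m.1 ∧ inI2 Y m.2
    then 1 / (Real.log m.1 * Real.log m.2) else 0) := by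
        apply Finset.sum_le_sum
        intro m hm
        obtain ⟨k, hk, rfl⟩ := Finset.mem_image.1 hm
        obtain ⟨c1, c2⟩ := hmsq k hk
        have c3 := hG k hk
        rw [if_pos ⟨by simp only; omega, c2, c3⟩]
        obtain ⟨d1, d2⟩ := hd _ c2
        obtain ⟨d3, d4⟩ := hd2 _ c3
        apply one_div_le_one_div_of_le (mul_pos d1 d3)
        exact mul_le_mul d2 d4 d3.le hL.le
    _ ≤ _ := by
        apply Finset.sum_le_sum_of_subset_of_nonneg
        · intro m hm
          obtain ⟨k, hk, rfl⟩ := Finset.mem_image.1 hm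
          obtain ⟨c1, c2⟩ := hmsq k hk
          obtain ⟨c3, c4⟩ := hG k hk
          have hk0 : 0 < k := by
            have : (0:ℝ) < k := by linarith
            exact_mod_cast this
          simp only [Finset.mem_product, Finset.mem_Ioc]
          refine ⟨⟨by omega, by omega⟩, hk0, ?_⟩
          nlinarith
        · intro m _ _
          split_ifs with hc
          · obtain ⟨d1, d2⟩ := hd _ hc.2.1
            obtain ⟨d3, d4⟩ := hd2 _ hc.2.2
            positivity
          · exact le_refl _

theorem Pi_lower (n Z : ℕ) (hn : H2mem n) (L : ℝ) 
    (h4 : ∏ p ∈ (Z+1).primesBelow, (1+4/(p:ℝ)) ≤ L^17) :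
    (L^17)⁻¹ ≤ PiS (Z+1).primesBelow n := by
  have h0 : 0 < ∏ p ∈ (Z+1).primesBelow, (1+4/(p:ℝ)) := Finset.prod_pos (fun p _ => by positivity)
  calc (L^17)⁻¹ ≤ (∏ p ∈ (Z+1).primesBelow, (1+4/(p:ℝ)))⁻¹ := by gcongr
    _ = ∏ p ∈ (Z+1).primesBelow, (1+4/(p:ℝ))⁻¹ := by rw [Finset.prod_inv_distrib]
    _ ≤ _ := by
      unfold PiS
      apply Finset.prod_le_prod (fun p _ => by positivity)
      intro p hp
      exact fp_lower n hn p (Nat.prime_of_mem_primesBelow hp)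

theorem core_n (η δ L X Y H P z₀ : ℝ) (Z b Q n : ℕ)
    (hL : 4 ≤ L) (hXL : Real.log X = L) (hη : 0 < η) (hδ : 5*η ≤ δ)
    (h6 : ∏ p ∈ (Z+1).primesBelow, (1+6/(p:ℝ)) ≤ L^25)
    (h4 : ∏ p ∈ (Z+1).primesBelow, (1+4/(p:ℝ)) ≤ L^17)
    (hlog : L^(1-2*η) ≤ Real.log (Z+1))
    (htail : (1/2:ℝ)^(2*b) * L^44 ≤ 1/4)
    (hP : 0 < P) (hPZ : P ≤ Z) (hQ : Z^(2*b) ≤ Q) (hZ : 1 ≤ Z)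
    (hzZ : (Z:ℝ) ≤ z₀) (hXZ : (Z:ℝ) < X - Y) (hY : 16 ≤ Y) (hXY : Y + 2 ≤ X) (hH : H < Y/4)
    (hY2 : 2 ≤ Y^(1/4:ℝ))
    (hσ : ∀ R : Finset ℕ, (∀ p ∈ R, p.Prime ∧ z₀ ≤ p ∧ (p:ℝ) ≤ Y^(1/4:ℝ)) →
      ∑ p ∈ R, 1/(p:ℝ) ≤ L^(-1+η))
    (herr : Y^(1/4:ℝ) * (2*(Q:ℝ)^2) ≤ √Y * (L^20)⁻¹)
    (h1 : X < n) (h2 : n ≤ X + H) (hn : H2mem n)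
    (hE : |bigE (Z+1).primesBelow b P n| ≤ (L^18)⁻¹) :
    (R0cnt X Y z₀ n : ℝ) ≤ 24 * r2 X Y n * (SS2 n P).re * L ^ (-1 + δ : ℝ) := by
  have hL0 : 0 < L := by linarith
  have hPi := Pi_lower n Z hn L h4
  set Pi := PiS (Z+1).primesBelow n with hPidef
  have hPi0 : 0 < Pi := lt_of_lt_of_le (by positivity) hPi
  have hT : (1/2:ℝ)^(2*b) * ∏ p ∈ (Z+1).primesBelow, (1+6/(p:ℝ)) ≤ (1/4) * (L^2)⁻¹ * Pi := by
    calc _ ≤ (1/2:ℝ)^(2*b) * L^25 := by gcongr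
      _ = ((1/2:ℝ)^(2*b) * L^44) * (L^2)⁻¹ * (L^17)⁻¹ := by field_simp
      _ ≤ _ := by gcongr
  have hL2 : (L^2)⁻¹ ≤ 1 := inv_le_one_of_one_le₀ (by nlinarith)
  have hSS : Pi/2 ≤ (SS2 n P).re := by
    apply SS2_lower n Z b P hP.le hPZ
    · refine hE.trans ?_
      have : (L^18)⁻¹ = L⁻¹ * (L^17)⁻¹ := by field_simp
      rw [this]
      have : L⁻¹ ≤ 1/4 := by rw [inv_le_comm₀ hL0 (by norm_num)]; norm_num; exact hL
      calc L⁻¹ * (L^17)⁻¹ ≤ 1/4 * Pi := by gcongr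
        _ = _ := by ring
    · refine hT.trans ?_
      nlinarith
  have hV : Vs n Z b ≤ 2 * Pi * L^(-2+4*η) := by
    unfold Vs
    have a1 : (1/Real.log (Z+1))^2 ≤ L^(-2+4*η) := by
      have : L^(-2+4*η) = (1/L^(1-2*η))^2 := by
        rw [one_div, ← Real.rpow_neg hL0.le, ← Real.rpow_natCast, ← Real.rpow_mul hL0.le]
        congr 1; push_cast; ring
      rw [this]
      have : 0 < L^(1-2*η) := by positivity
      have h0 : 0 ≤ 1 / Real.log (Z+1) := one_div_nonneg.2 (this.le.trans hlog)
      gcongr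
    have a2 : (L^2)⁻¹ ≤ L^(-2+4*η) := by
      rw [← Real.rpow_natCast, ← Real.rpow_neg hL0.le]
      apply Real.rpow_le_rpow_of_exponent_le (by linarith)
      push_cast; linarith
    have a3 : 0 < L^(-2+4*η) := by positivity
    have a4 : (1/4) * (L^2)⁻¹ * Pi ≤ Pi * L^(-2+4*η) := by
      have := mul_le_mul_of_nonneg_right a2 hPi0.le
      have h5 : 0 ≤ (L^2)⁻¹ * Pi := by positivity
      linarith
    have a5 := mul_le_mul_of_nonneg_left a1 hPi0.le
    rw [← hPidef]
    linarith
  have hR := R0_bd X Y z₀ n Z b Q hQ hZ hzZ hXZ (by linarith) hY2 hPi0.le _ hσ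
  have hr := r2_lower X Y H n hY hXY hH h1 h2
  rw [hXL] at hr
  have hY4 : √Y ≤ r2 X Y n * (4 * L^2) := (div_le_iff₀ (by positivity)).1 hr
  have hr0 : 0 ≤ r2 X Y n := le_trans (by positivity) hr
  have b1 : (L^20)⁻¹ ≤ L^(-3+5*η) * Pi := by
    have : (L^20)⁻¹ = L^(-3:ℝ) * (L^17)⁻¹ := by
      rw [Real.rpow_neg hL0.le]; norm_cast; field_simp
    rw [this]
    have : L^(-3:ℝ) ≤ L^(-3+5*η) := Real.rpow_le_rpow_of_exponent_le (by linarith) (by linarith)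
    gcongr
  have b2 : L^(-3+5*η) = L^(-1+η) * L^(-2+4*η) := by
    rw [← Real.rpow_add hL0]; congr 1; ring
  have b3 : L^2 * L^(-3+5*η) ≤ L^(-1+δ) := by
    rw [← Real.rpow_natCast, ← Real.rpow_add hL0]
    apply Real.rpow_le_rpow_of_exponent_le (by linarith)
    push_cast; linarith
  have hSS0 : 0 ≤ (SS2 n P).re := by linarith
  calc (R0cnt X Y z₀ n : ℝ) ≤ √Y * L^(-1+η) * Vs n Z b + Y^(1/4:ℝ) * (2 * (Q:ℝ)^2) := hR
    _ ≤ √Y * L^(-1+η) * (2 * Pi * L^(-2+4*η)) + √Y * (L^(-3+5*η) * Pi) := by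
        apply add_le_add
        · gcongr
        · exact herr.trans (by gcongr)
    _ = 3 * √Y * Pi * L^(-3+5*η) := by rw [b2]; ring
    _ ≤ 3 * (r2 X Y n * (4 * L^2)) * (2 * (SS2 n P).re) * L^(-3+5*η) := by
        gcongr; linarith
    _ = 24 * r2 X Y n * (SS2 n P).re * (L^2 * L^(-3+5*η)) := by ring
    _ ≤ _ := by gcongr

theorem core (A η δ L X Y H P z₀ : ℝ) (Z b Q : ℕ)
    (hL : 4 ≤ L) (hXL : Real.log X = L) (hη : 0 < η) (hδ : 5*η ≤ δ)
    (h9 : ∏ p ∈ (Z+1).primesBelow, (1+9/(p:ℝ)) ≤ L^37)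
    (h6 : ∏ p ∈ (Z+1).primesBelow, (1+6/(p:ℝ)) ≤ L^25)
    (h4 : ∏ p ∈ (Z+1).primesBelow, (1+4/(p:ℝ)) ≤ L^17)
    (hlog : L^(1-2*η) ≤ Real.log (Z+1))
    (htail : (1/2:ℝ)^(2*b) * L^44 ≤ 1/4)
    (hP : 0 < P) (hPZ : P ≤ Z) (hQ : Z^(2*b) ≤ Q) (hZ : 1 ≤ Z)
    (hzZ : (Z:ℝ) ≤ z₀) (hXZ : (Z:ℝ) < X - Y) (hY : 16 ≤ Y) (hXY : Y + 2 ≤ X) (hH : H < Y/4)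
    (hY2 : 2 ≤ Y^(1/4:ℝ))
    (hσ : ∀ R : Finset ℕ, (∀ p ∈ R, p.Prime ∧ z₀ ≤ p ∧ (p:ℝ) ≤ Y^(1/4:ℝ)) →
      ∑ p ∈ R, 1/(p:ℝ) ≤ L^(-1+η))
    (herr : Y^(1/4:ℝ) * (2*(Q:ℝ)^2) ≤ √Y * (L^20)⁻¹)
    (hH1 : 1 ≤ H) (hexc : (Q:ℝ)^4 * L^36 ≤ H * L^(-A)) (hPe : P⁻¹ * L^73 ≤ L^(-A)) :
    (Nat.card {n : ℕ | X < (n : ℝ) ∧ (n : ℝ) ≤ X + H ∧ H2mem n ∧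
        ¬ ((R0cnt X Y z₀ n : ℝ) ≤ 24 * r2 X Y n * (SS2 n P).re * L ^ (-1 + δ : ℝ))} : ℝ)
      ≤ 4 * H * L ^ (-A) := by
  have hL0 : 0 < L := by linarith
  have hX0 : 0 < X := by linarith
  set a := ⌊X⌋₊ + 1 with ha
  set h := ⌊H⌋₊ + 1 with hh
  set E := (Finset.Ico a (a+h)).filter (fun n => (L^18)⁻¹ < |bigE (Z+1).primesBelow b P n|) with hE
  have hsub : {n : ℕ | X < (n : ℝ) ∧ (n : ℝ) ≤ X + H ∧ H2mem n ∧
        ¬ ((R0cnt X Y z₀ n : ℝ) ≤ 24 * r2 X Y n * (SS2 n P).re * L ^ (-1 + δ : ℝ))} ⊆ (E : Set ℕ) := by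
    rintro n ⟨n1, n2, n3, n4⟩
    rw [Finset.mem_coe, hE, Finset.mem_filter, Finset.mem_Ico]
    refine ⟨⟨?_, ?_⟩, ?_⟩
    · have : ⌊X⌋₊ < n := (Nat.floor_lt hX0.le).2 n1
      omega
    · have c1 := Nat.lt_floor_add_one X
      have c2 := Nat.lt_floor_add_one H
      have : (n:ℝ) < ((a + h : ℕ):ℝ) := by
        rw [ha, hh]; push_cast; linarith
      exact_mod_cast this
    · by_contra hcon
      exact n4 (core_n η δ L X Y H P z₀ Z b Q n hL hXL hη hδ h6 h4 hlog htail hP hPZ hQ hZ hzZ hXZ hY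
        hXY hH hY2 hσ herr n1 n2 n3 (not_lt.1 hcon))
  have hc : Nat.card {n : ℕ | X < (n : ℝ) ∧ (n : ℝ) ≤ X + H ∧ H2mem n ∧
        ¬ ((R0cnt X Y z₀ n : ℝ) ≤ 24 * r2 X Y n * (SS2 n P).re * L ^ (-1 + δ : ℝ))} ≤ E.card := by
    have := Nat.card_mono (Finset.finite_toSet E) hsub
    simpa using this
  have hx := exc_bd Z b Q P (L^18)⁻¹ hP (by positivity) hQ hZ a h
  rw [← hE] at hx
  have hh2 : (h:ℝ) ≤ 2*H := by
    rw [hh]; push_cast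
    have := Nat.floor_le (show 0 ≤ H by linarith)
    linarith
  have hEc : (E.card : ℝ) ≤ 4 * H * L^(-A) := by
    calc (E.card : ℝ) = (E.card * ((L^18)⁻¹)^2) * L^36 := by field_simp
      _ ≤ (h * (P⁻¹ * ∏ p ∈ (Z+1).primesBelow, (1+9/(p:ℝ))) + 2 * (Q:ℝ)^4) * L^36 := by gcongr
      _ ≤ ((2*H) * (P⁻¹ * L^37) + 2 * (Q:ℝ)^4) * L^36 := by gcongr
      _ = (2*H) * (P⁻¹ * L^73) + 2 * ((Q:ℝ)^4 * L^36) := by ring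
      _ ≤ (2*H) * L^(-A) + 2 * (H * L^(-A)) := by gcongr
      _ = _ := by ring
  exact le_trans (by exact_mod_cast hc) hEc

theorem ev_pow (a b K κ : ℝ) (hab : a < b) (hκ : 0 < κ) :
    ∀ᶠ L : ℝ in Filter.atTop, K * L^a ≤ κ * L^b := by
  have h := tendsto_rpow_atTop (show 0 < b - a by linarith)
  filter_upwards [h.eventually_ge_atTop (K/κ), Filter.eventually_gt_atTop 0] with L h1 h2
  have : L^b = L^(b-a) * L^a := by rw [← Real.rpow_add h2]; congr 1; ring
  rw [this, ← mul_assoc]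
  rw [div_le_iff₀ hκ] at h1
  apply mul_le_mul_of_nonneg_right _ (by positivity)
  linarith

theorem ev_log (b K κ : ℝ) (hb : 0 < b) (hκ : 0 < κ) :
    ∀ᶠ L : ℝ in Filter.atTop, K * Real.log L ≤ κ * L^b := by
  have h := (isLittleO_log_rpow_atTop hb).def (show 0 < κ/(|K|+1) by positivity)
  filter_upwards [h, Filter.eventually_gt_atTop 1] with L h1 h2
  have hl : 0 < Real.log L := Real.log_pos h2
  have hp : 0 < L^b := by positivity
  rw [Real.norm_of_nonneg hl.le, Real.norm_of_nonneg hp.le] at h1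
  rw [div_mul_eq_mul_div, le_div_iff₀ (by positivity)] at h1
  have : K ≤ |K| + 1 := by linarith [le_abs_self K]
  nlinarith

theorem ev_const (b K κ : ℝ) (hb : 0 < b) (hκ : 0 < κ) :
    ∀ᶠ L : ℝ in Filter.atTop, K ≤ κ * L^b := by
  filter_upwards [ev_pow 0 b K κ hb hκ] with L h
  simpa using h

theorem prod_bd (Z : ℕ) (L : ℝ) (hL : Real.exp 36 ≤ L) (hZ : (Nat.log 2 Z:ℝ) ≤ L) (k : ℕ) (hk : k ≤ 9) :
    ∏ p ∈ (Z+1).primesBelow, (1+(k:ℝ)/(p:ℝ)) ≤ L^(4*k+1) := by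
  have h1 : (1:ℝ) ≤ Real.exp 36 := Real.one_le_exp (by norm_num)
  have := mertens_prod Z L (by linarith) hZ k (by positivity)
  refine this.trans ?_
  have e1 : L^(4*(k:ℝ)) = L^(4*k) := by
    rw [← Real.rpow_natCast]; push_cast; rfl
  rw [e1, pow_succ']
  have : Real.exp (4*(k:ℝ)) ≤ L := by
    refine le_trans (Real.exp_le_exp.2 ?_) hL
    have : (k:ℝ) ≤ 9 := by exact_mod_cast hk
    linarith
  have : 0 ≤ L := by linarith
  gcongr

theorem two_le_exp_one : (2:ℝ) ≤ Real.exp 1 := by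
  have := Real.add_one_le_exp (1:ℝ); linarith

theorem four_le_exp_two : (4:ℝ) ≤ Real.exp 2 := by
  have h : Real.exp 2 = Real.exp 1 * Real.exp 1 := by rw [← Real.exp_add]; norm_num
  rw [h]; nlinarith [two_le_exp_one]

theorem exp_pow_log (L : ℝ) (hL : 0 < L) (k : ℕ) : L^k = Real.exp (k * Real.log L) := by
  rw [Real.exp_nat_mul, Real.exp_log hL]

set_option maxHeartbeats 2000000 in
theorem final (A B θ δ ε : ℝ) (hA : 0 < A) (hB : A + 74 ≤ B) (hθ : 0 < θ) (hθ1 : θ < 1)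
    (hδ : 0 < δ) (hε : 0 < ε) : ∀ᶠ L : ℝ in Filter.atTop, ∀ X H Y P z₀ : ℝ, X = Real.exp L →
      Y = X^θ → P = L^B → z₀ = Y^(1/4:ℝ) * P^(-2:ℝ) → Y^ε ≤ H → H ≤ Y^(1-ε:ℝ) →
    (Nat.card {n : ℕ | X < (n : ℝ) ∧ (n : ℝ) ≤ X + H ∧ H2mem n ∧
        ¬ ((R0cnt X Y z₀ n : ℝ) ≤ 24 * r2 X Y n * (SS2 n P).re * L ^ (-1 + δ : ℝ))} : ℝ)
      ≤ 4 * H * L ^ (-A) := by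
  obtain ⟨η, hη, hη8, hηδ⟩ : ∃ η : ℝ, 0 < η ∧ η ≤ 1/8 ∧ 5*η ≤ δ := by
    refine ⟨min δ 1 / 8, by positivity, ?_, ?_⟩
    · have := min_le_right δ 1; linarith
    · have := min_le_left δ 1; linarith
  have hεθ : 0 < ε * θ := by positivity
  filter_upwards [Filter.eventually_ge_atTop (Real.exp 36), Filter.eventually_ge_atTop 4,
    ev_log (1-2*η) (2*B) 1 (by linarith) one_pos,
    ev_const (1-2*η) 2 1 (by linarith) one_pos,
    ev_pow (1-2*η) 1 2 1 (by linarith) one_pos,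
    ev_log η 88 1 hη one_pos, ev_const η 4 1 hη one_pos,
    ev_pow (1-η) 1 32 (ε*θ) (by linarith) hεθ,
    ev_log 1 (2*(A+36)) (ε*θ) one_pos hεθ,
    ev_log 1 (2*B) (θ/16) one_pos (by positivity),
    ev_pow (1-2*η) 1 1 (θ/16) (by linarith) (by positivity),
    ev_const 1 2 (θ/16) one_pos (by positivity),
    ev_log η (32*B) (θ/8) hη (by positivity),
    ev_const η 32 (θ/8) hη (by positivity),
    ev_pow (1-η) 1 8 (θ/16) (by linarith) (by positivity),
    ev_log 1 20 (θ/16) one_pos (by positivity),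
    ev_const 1 1 (1-θ) one_pos (by linarith),
    ev_const 1 4 1 one_pos one_pos,
    ev_const 1 3 (ε*θ) one_pos hεθ] with L g36 g4 g1 g2 g3 g5 g6 g7 g8 g9 g10 g11 g12 g13 g14 g15 g16 g17 g18
  intro X H Y P z₀ hX hY hP hz₀ hH1 hH2
  simp only [Real.rpow_one, one_mul] at *
  have hL0 : 0 < L := by linarith
  set l := Real.log L with hl
  have hl0 : 0 < l := Real.log_pos (by linarith)
  set s := L^(1-2*η) with hs
  have hs0 : 0 < s := by positivity
  set t := L^(1-η) with ht
  set Z := ⌊Real.exp s⌋₊ with hZdef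
  set b := ⌈L^η⌉₊ with hb
  have hZle : (Z:ℝ) ≤ Real.exp s := Nat.floor_le (Real.exp_pos _).le
  have hZlt : Real.exp s < Z + 1 := Nat.lt_floor_add_one _
  have hZ1 : 1 ≤ Z := Nat.le_floor (by push_cast; exact Real.one_le_exp hs0.le)
  have hYe : Y = Real.exp (θ*L) := by rw [hY, hX, ← Real.exp_mul]; ring_nf
  have hYr : ∀ u : ℝ, Y^u = Real.exp (θ*L*u) := by intro u; rw [hYe, ← Real.exp_mul]
  have hPe : P = Real.exp (B*l) := by rw [hP, Real.rpow_def_of_pos hL0, ← hl]; ring_nf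
  have hz₀e : z₀ = Real.exp (θ*L/4 - 2*B*l) := by
    rw [hz₀, hYr, hPe, ← Real.exp_mul, ← Real.exp_add]; ring_nf
  have hsq : √Y = Real.exp (θ*L/2) := by
    rw [Real.sqrt_eq_rpow, hYr]; ring_nf
  have hLA : L^(-A) = Real.exp (-A*l) := by rw [Real.rpow_def_of_pos hL0, ← hl]; ring_nf
  have hblo : L^η ≤ b := Nat.le_ceil _
  have hbhi : (b:ℝ) ≤ 2*L^η := by
    have := Nat.ceil_lt_add_one (show 0 ≤ L^η by positivity)
    linarith
  have hQe : ((Z^(2*b) : ℕ):ℝ) ≤ Real.exp (4*t) := by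
    push_cast
    calc (Z:ℝ)^(2*b) ≤ (Real.exp s)^(2*b) := by gcongr
      _ = Real.exp (s*(2*b)) := by rw [← Real.exp_nat_mul]; push_cast; ring_nf
      _ ≤ Real.exp (4*t) := by
        apply Real.exp_le_exp.2
        have : t = s * L^η := by rw [ht, hs, ← Real.rpow_add hL0]; congr 1; ring
        rw [this]
        have := mul_le_mul_of_nonneg_left hbhi hs0.le
        linarith
  have hlog2 : (Nat.log 2 Z:ℝ) ≤ L := by
    have c1 : ((2^(Nat.log 2 Z):ℕ):ℝ) ≤ Z := by exact_mod_cast Nat.pow_log_le_self 2 (by omega)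
    push_cast at c1
    have c2 := Real.log_le_log (by positivity) (c1.trans hZle)
    rw [Real.log_pow, Real.log_exp] at c2
    have := Real.log_two_gt_d9
    have h0 : 0 ≤ (Nat.log 2 Z:ℝ) := by positivity
    have := mul_le_mul_of_nonneg_left (show (1/2:ℝ) ≤ Real.log 2 by linarith) h0
    linarith
  have h9 := prod_bd Z L g36 hlog2 9 (by norm_num)
  have h6 := prod_bd Z L g36 hlog2 6 (by norm_num)
  have h4 := prod_bd Z L g36 hlog2 4 (by norm_num)
  norm_num at h9 h6 h4
  refine core A η δ L X Y H P z₀ Z b (Z^(2*b)) g4 (by rw [hX, Real.log_exp]) hη hηδ h9 h6 h4 ?_ ?_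
    ?_ ?_ le_rfl hZ1 ?_ ?_ ?_ ?_ ?_ ?_ ?_ ?_ ?_ ?_ ?_
  · rw [← hs, ← Real.log_exp s]
    exact Real.log_le_log (Real.exp_pos _) hZlt.le
  · have c1 : (1/2:ℝ)^(2*b) ≤ Real.exp (-L^η) := by
      have : (1/4:ℝ) ≤ Real.exp (-1) := by
        rw [Real.exp_neg, one_div]
        apply inv_anti₀ (Real.exp_pos _)
        have := Real.exp_one_lt_d9; linarith
      rw [pow_mul]
      norm_num
      calc (1/4:ℝ)^b ≤ (Real.exp (-1))^b := by gcongr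
        _ = Real.exp (-b) := by rw [← Real.exp_nat_mul]; ring_nf
        _ ≤ _ := Real.exp_le_exp.2 (by linarith)
    rw [exp_pow_log L hL0]
    calc _ ≤ Real.exp (-L^η) * Real.exp ((44:ℕ)*Real.log L) := by gcongr
      _ = Real.exp (-L^η + 44*l) := by rw [← Real.exp_add]; push_cast; rfl
      _ ≤ Real.exp (-2) := Real.exp_le_exp.2 (by linarith)
      _ ≤ 1/4 := by
        rw [Real.exp_neg, one_div]
        exact inv_anti₀ (by norm_num) four_le_exp_two
  · rw [hPe]; positivity
  · have c1 : P + 1 ≤ Real.exp s := by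
      have : 1 ≤ P := by rw [hPe]; exact Real.one_le_exp (mul_nonneg (by linarith) hl0.le)
      calc P + 1 ≤ P * 2 := by linarith
        _ ≤ P * Real.exp 1 := by have := two_le_exp_one; gcongr
        _ = Real.exp (B*l+1) := by rw [hPe, Real.exp_add]
        _ ≤ _ := Real.exp_le_exp.2 (by linarith)
    linarith
  · refine hZle.trans ?_
    rw [hz₀e]; exact Real.exp_le_exp.2 (by linarith)
  · have c1 : Y * 2 ≤ X := by
      calc Y * 2 ≤ Y * Real.exp 1 := by have := two_le_exp_one; have : 0 < Y := by { rw [hYe]; positivity }; gcongr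
        _ = Real.exp (θ*L+1) := by rw [hYe, Real.exp_add]
        _ ≤ X := by rw [hX]; exact Real.exp_le_exp.2 (by linarith)
    have c2 : Real.exp s * 4 ≤ X := by
      calc Real.exp s * 4 ≤ Real.exp s * Real.exp 2 := by have := four_le_exp_two; gcongr
        _ = Real.exp (s + 2) := by rw [Real.exp_add]
        _ ≤ X := by rw [hX]; exact Real.exp_le_exp.2 (by linarith)
    have := Real.exp_pos s
    linarith
  · have c : Real.exp 4 ≤ Y := by rw [hYe]; exact Real.exp_le_exp.2 (by linarith)
    have : Real.exp 4 = Real.exp 2 * Real.exp 2 := by rw [← Real.exp_add]; norm_num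
    have := mul_le_mul four_le_exp_two four_le_exp_two (by norm_num) (Real.exp_pos 2).le
    linarith
  · have c1 : Y * 2 ≤ X := by
      calc Y * 2 ≤ Y * Real.exp 1 := by have := two_le_exp_one; have : 0 < Y := by { rw [hYe]; positivity }; gcongr
        _ = Real.exp (θ*L+1) := by rw [hYe, Real.exp_add]
        _ ≤ X := by rw [hX]; exact Real.exp_le_exp.2 (by linarith)
    have c2 : Real.exp 2 ≤ X := by rw [hX]; exact Real.exp_le_exp.2 (by linarith)
    linarith [four_le_exp_two]
  · have c1 : H * 4 < Y := by
      have hpos : 0 < Y^(1-ε) := by rw [hYr]; positivity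
      calc H * 4 ≤ Y^(1-ε) * 4 := by gcongr
        _ ≤ Y^(1-ε) * Real.exp 2 := by have := four_le_exp_two; gcongr
        _ = Real.exp (θ*L*(1-ε) + 2) := by rw [hYr, Real.exp_add]
        _ < Real.exp (θ*L) := Real.exp_lt_exp.2 (by linarith)
        _ = Y := hYe.symm
    linarith
  · rw [hYr]
    exact two_le_exp_one.trans (Real.exp_le_exp.2 (by linarith))
  · intro R hR
    have hz4 : 4 ≤ z₀ := by
      rw [hz₀e]; exact four_le_exp_two.trans (Real.exp_le_exp.2 (by linarith))
    rcases R.eq_empty_or_nonempty with rfl | ⟨p, hp⟩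
    · simp; positivity
    have := recip_range z₀ (Y^(1/4:ℝ)) hz4 ((hR p hp).2.1.trans (hR p hp).2.2) R hR
    refine this.trans ?_
    rw [hYr, hz₀e, Real.log_exp, Real.log_exp]
    have hd : θ*L/8 ≤ θ*L/4 - 2*B*l := by linarith
    have hd0 : 0 < θ*L/8 := by positivity
    rw [div_le_iff₀ (by linarith)]
    have : L^(-1+η) * (θ*L/8) = θ/8 * L^η := by
      have : L^η = L^(-1+η) * L := by
        rw [← Real.rpow_add_one hL0.ne']; congr 1; ring
      rw [this]; ring
    have h5 : L^(-1+η) * (θ*L/8) ≤ L^(-1+η) * (θ*L/4 - 2*B*l) := by gcongr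
    linarith
  · rw [hYr, hsq, exp_pow_log L hL0, ← Real.exp_neg, ← Real.exp_add]
    have c : (2:ℝ) * ((Z^(2*b):ℕ):ℝ)^2 ≤ Real.exp (1 + 8*t) := by
      calc (2:ℝ) * ((Z^(2*b):ℕ):ℝ)^2 ≤ Real.exp 1 * (Real.exp (4*t))^2 := by
            have := two_le_exp_one
            gcongr
        _ = _ := by rw [← Real.exp_nat_mul, ← Real.exp_add]; push_cast; ring_nf
    calc _ ≤ Real.exp (θ*L*(1/4)) * Real.exp (1+8*t) := by gcongr
      _ = Real.exp (θ*L*(1/4) + (1+8*t)) := (Real.exp_add _ _).symm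
      _ ≤ _ := by
        apply Real.exp_le_exp.2
        push_cast
        rw [← hl]
        linarith
  · refine le_trans ?_ hH1
    rw [hYr]; exact Real.one_le_exp (by positivity)
  · rw [exp_pow_log L hL0, hLA]
    calc _ ≤ (Real.exp (4*t))^4 * Real.exp ((36:ℕ)*Real.log L) := by gcongr
      _ = Real.exp (16*t + 36*l) := by
        rw [← Real.exp_nat_mul, ← Real.exp_add, ← hl]; push_cast; ring_nf
      _ ≤ Real.exp (θ*L*ε + -A*l) := Real.exp_le_exp.2 (by linarith)
      _ = Y^ε * Real.exp (-A*l) := by rw [Real.exp_add, hYr]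
      _ ≤ _ := by gcongr
  · rw [hPe, hLA, exp_pow_log L hL0, ← Real.exp_neg, ← Real.exp_add]
    apply Real.exp_le_exp.2
    push_cast
    rw [← hl]
    have := mul_le_mul_of_nonneg_right hB hl0.le
    linarith

/-- Proposition 2 of the paper. -/
theorem statement5 :
    ∀ A : ℝ, 0 < A → ∃ B₀ : ℝ, 0 < B₀ ∧
    ∀ θ₁ : ℝ, θ₁ ∈ Set.Ioo (0 : ℝ) 1 → ∀ δ ε : ℝ, 0 < δ → 0 < ε →
    ∃ C C' : ℝ, 0 < C ∧ 0 < C' ∧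
    ∀ B : ℝ, B₀ ≤ B → ∃ X₀ : ℝ, ∀ X H : ℝ, X₀ ≤ X →
    ∀ Y L P z₀ : ℝ, Y = X ^ θ₁ → L = Real.log X → P = L ^ B →
    z₀ = Y ^ (1/4 : ℝ) * P ^ (-2 : ℝ) →
    Y ^ ε ≤ H → H ≤ Y ^ (1 - ε : ℝ) →
    (Nat.card {n : ℕ | X < (n : ℝ) ∧ (n : ℝ) ≤ X + H ∧ H2mem n ∧
        ¬ ((R0cnt X Y z₀ n : ℝ) ≤ C * r2 X Y n * (SS2 n P).re * L ^ (-1 + δ : ℝ))} : ℝ)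
      ≤ C' * H * L ^ (-A) := by
  intro A hA
  refine ⟨A + 74, by linarith, ?_⟩
  intro θ hθ δ ε hδ hε
  refine ⟨24, 4, by norm_num, by norm_num, ?_⟩
  intro B hB
  obtain ⟨L₀, hL₀⟩ := Filter.eventually_atTop.1 (final A B θ δ ε hA hB hθ.1 hθ.2 hδ hε)
  refine ⟨Real.exp L₀, ?_⟩
  intro X H hX Y L P z₀ hY hL hP hz₀ h1 h2
  have hX0 : 0 < X := (Real.exp_pos _).trans_le hX
  have hLL : L₀ ≤ L := by rw [hL]; exact (Real.le_log_iff_exp_le hX0).2 hX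
  exact hL₀ L hLL X H Y P z₀ (by rw [hL, Real.exp_log hX0]) hY hP hz₀ h1 h2
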